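/- arXiv:1006.1297 — 7 statements merged into one kernel-verified Lean document; each statement's English description precedes it below -/
import Mathlib

section
/- Fix integers n ≥ 1 and 1 ≤ k ≤ n. The number of pairs (a, i), where a is a Dyck path of length 2n (an element of 𝒟_(2n,0)) and i ∈ {0,1,…,2n−1} is a position at which a takes a down-step from height k to height k−1 (i.e. a(i) = k and a(i+1) = k−1), equals C(2n, n−k) − C(2n, n−k−1). -/
/-- A nonnegative lattice path of length `2*n` from `0` to `h`:
`a 0 = 0`, `a (2n) = h`, all values nonnegative, and each step `±1`. -/
def IsLatticePath (n : ℕ) (h : ℤ) (a : Fin (2 * n + 1) → ℤ) : Prop :=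
  a 0 = 0 ∧ a (Fin.last (2 * n)) = h ∧ (∀ i, 0 ≤ a i) ∧
    ∀ i : Fin (2 * n), a i.succ - a i.castSucc = 1 ∨ a i.succ - a i.castSucc = -1

/-- Binomial coefficient `C(m, r)` with the convention that it is `0` for `r < 0`. -/
def ch (m : ℕ) (r : ℤ) : ℕ := if r < 0 then 0 else m.choose r.toNat

def dsF : ℕ → ℤ → ℤ
  | 0, h => if h = 0 then 1 else 0
  | m + 1, h => dsF m (h - 1) + dsF m (h + 1)

theorem dsF_neg (m : ℕ) : ∀ h, dsF m (-h) = dsF m h := by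
  induction m with
  | zero => intro h; simp [dsF]
  | succ m ih =>
    intro h
    simp only [dsF]
    rw [← ih (h - 1), ← ih (h + 1), add_comm]
    congr 2 <;> ring

theorem dsF_big (m : ℕ) : ∀ h : ℤ, (m : ℤ) < h → dsF m h = 0 := by
  induction m with
  | zero => intro h hh; simp [dsF]; intro h0; simp at hh; omega
  | succ m ih =>
    intro h hh
    push_cast at hh
    simp only [dsF]
    rw [ih _ (by omega), ih _ (by omega)]; rfl

theorem dsF_choose (m : ℕ) : ∀ r : ℕ, dsF m ((m : ℤ) - 2 * r) = m.choose r := by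
  induction m with
  | zero =>
    intro r
    cases r with
    | zero => simp [dsF]
    | succ r => simp [dsF]; omega
  | succ m ih =>
    intro r
    simp only [dsF]
    cases r with
    | zero =>
      have := ih 0
      rw [dsF_big m (_ + 1) (by push_cast; omega)]
      simpa using this
    | succ r =>
      rw [Nat.choose_succ_succ]
      push_cast
      rw [← ih r, ← ih (r + 1), add_comm]
      congr 2 <;> push_cast <;> ring

def dsP : (m : ℕ) → ℤ → Finset (Fin (m + 1) → ℤ)
  | 0, s => if s = 0 then {fun _ => 0} else ∅
  | m + 1, s => if 0 ≤ s then
      (dsP m (s + 1) ∪ dsP m (s - 1)).image (fun a => (Fin.cons s a : Fin (m + 2) → ℤ)) else ∅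

theorem mem_dsP (m : ℕ) : ∀ (s : ℤ) (a : Fin (m + 1) → ℤ), a ∈ dsP m s ↔
    (a 0 = s ∧ a (Fin.last m) = 0 ∧ (∀ i, 0 ≤ a i) ∧
    ∀ i : Fin m, a i.succ - a i.castSucc = 1 ∨ a i.succ - a i.castSucc = -1) := by
  induction m with
  | zero =>
    intro s a
    simp only [dsP]
    constructor
    · intro h
      split_ifs at h with h0
      · simp at h; subst h; simp [h0]
      · simp at h
    · rintro ⟨h1, h2, -, -⟩
      have h2' : a 0 = 0 := h2
      have : s = 0 := by omega
      simp only [this, if_true, Finset.mem_singleton]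
      funext i
      rw [Fin.fin_one_eq_zero i, h2']
  | succ m ih =>
    intro s a
    simp only [dsP]
    refine Fin.consCases (fun x b => ?_) a
    rw [Fin.forall_fin_succ, Fin.forall_fin_succ (P := fun i => (Fin.cons x b : Fin (m + 2) → ℤ) i.succ - (Fin.cons x b : Fin (m + 2) → ℤ) i.castSucc = 1 ∨ (Fin.cons x b : Fin (m + 2) → ℤ) i.succ - (Fin.cons x b : Fin (m + 2) → ℤ) i.castSucc = -1), ← Fin.succ_last]
    simp only [Fin.cons_zero, Fin.cons_succ, Fin.castSucc_zero, ← Fin.succ_castSucc]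
    constructor
    · intro h
      split_ifs at h with h0
      · simp only [Finset.mem_image, Finset.mem_union, ih] at h
        obtain ⟨c, hc, he⟩ := h
        obtain ⟨rfl, rfl⟩ := Fin.cons_injective2 he
        rcases hc with ⟨h1, h2, h3, h4⟩ | ⟨h1, h2, h3, h4⟩
        · exact ⟨rfl, h2, ⟨h0, h3⟩, by omega, h4⟩
        · exact ⟨rfl, h2, ⟨h0, h3⟩, by omega, h4⟩
      · simp at h
    · rintro ⟨rfl, h2, ⟨h0, h3⟩, h5, h4⟩
      rw [if_pos h0]
      simp only [Finset.mem_image, Finset.mem_union, ih]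
      refine ⟨b, ?_, rfl⟩
      rcases h5 with h5 | h5
      · left; exact ⟨by omega, h2, h3, h4⟩
      · right; exact ⟨by omega, h2, h3, h4⟩

theorem dsP_neg (m : ℕ) (s : ℤ) (h : s < 0) : dsP m s = ∅ := by
  cases m with
  | zero => simp [dsP]; omega
  | succ m => simp [dsP]; omega

theorem sum_dsP (m : ℕ) (s : ℤ) (hs : 0 ≤ s) (g : (Fin (m + 2) → ℤ) → ℤ) :
    ∑ a ∈ dsP (m + 1) s, g a = ∑ a ∈ dsP m (s + 1), g (Fin.cons s a) +
      ∑ a ∈ dsP m (s - 1), g (Fin.cons s a) := by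
  simp only [dsP, if_pos hs]
  rw [Finset.sum_image (fun a _ b _ h => Fin.cons_right_injective _ h), Finset.sum_union]
  rw [Finset.disjoint_left]
  intro a h1 h2
  rw [mem_dsP] at h1 h2
  have := h1.1
  have := h2.1
  omega

theorem card_dsP (m : ℕ) : ∀ s : ℤ, 0 ≤ s → ∑ a ∈ dsP m s, (1 : ℤ) = dsF m s - dsF m (s + 2) := by
  induction m with
  | zero =>
    intro s hs
    simp only [dsP, dsF]
    rw [if_neg (by omega : ¬ s + 2 = 0)]
    split_ifs <;> simp
  | succ m ih =>
    intro s hs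
    rw [sum_dsP m s hs (fun _ => 1), ih _ (by omega)]
    simp only [dsF]
    rcases hs.eq_or_lt with rfl | h
    · rw [dsP_neg m _ (by omega)]
      have := dsF_neg m 1
      norm_num at this ⊢
      rw [this]
      ring
    · rw [ih _ (by omega)]
      ring_nf

def dsC (k : ℤ) (m : ℕ) (a : Fin (m + 1) → ℤ) : ℤ :=
  ∑ i : Fin m, if a i.castSucc = k ∧ a i.succ = k - 1 then 1 else 0

theorem dsC_cons (k : ℤ) (m : ℕ) (s : ℤ) (a : Fin (m + 1) → ℤ) :
    dsC k (m + 1) (Fin.cons s a) = (if s = k ∧ a 0 = k - 1 then 1 else 0) + dsC k m a := by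
  simp only [dsC]
  rw [Fin.sum_univ_succ]
  simp only [Fin.cons_zero, Fin.cons_succ, Fin.castSucc_zero, ← Fin.succ_castSucc]

theorem sum_dsC (k : ℤ) (hk : 1 ≤ k) (m : ℕ) : ∀ s : ℤ, 0 ≤ s →
    ∑ a ∈ dsP m s, dsC k m a = dsF m (max s (2 * k - s)) - dsF m (s + 2 * k + 2) := by
  induction m with
  | zero =>
    intro s hs
    simp only [dsF, dsC]
    rw [if_neg (by omega), if_neg (by omega)]
    simp
  | succ m ih =>
    intro s hs
    rw [sum_dsP m s hs]
    simp only [dsC_cons, Finset.sum_add_distrib]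
    have e1 : ∑ a ∈ dsP m (s + 1), (if s = k ∧ a 0 = k - 1 then (1 : ℤ) else 0) = 0 := by
      apply Finset.sum_eq_zero
      intro a ha
      rw [mem_dsP] at ha
      rw [if_neg]
      have := ha.1
      omega
    have e2 : ∑ a ∈ dsP m (s - 1), (if s = k ∧ a 0 = k - 1 then (1 : ℤ) else 0) =
        if s = k then dsF m (k - 1) - dsF m (k + 1) else 0 := by
      split_ifs with h
      · have := card_dsP m (k - 1) (by omega)
        rw [show k - 1 + 2 = k + 1 by ring] at this
        rw [← this, h]
        apply Finset.sum_congr rfl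
        intro a ha
        rw [mem_dsP] at ha
        rw [if_pos ⟨rfl, ha.1⟩]
      · simp [h]
    rw [e1, e2, ih _ (by omega)]
    simp only [dsF]
    rcases hs.eq_or_lt with rfl | h
    · rw [dsP_neg m (0 - 1) (by omega), if_neg (by omega), max_eq_right (by omega),
        max_eq_right (by omega)]
      simp only [Finset.sum_empty]
      ring_nf
    · rw [ih _ (by omega)]
      rcases lt_trichotomy s k with h1 | rfl | h1
      · rw [if_neg (by omega), max_eq_right (by omega), max_eq_right (by omega),
          max_eq_right (by omega)]
        ring_nf
      · rw [if_pos rfl, show max (s + 1) (2 * s - (s + 1)) = s + 1 by omega,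
          show max (s - 1) (2 * s - (s - 1)) = s + 1 by omega,
          show max s (2 * s - s) = s by omega]
        ring_nf
      · rw [if_neg (by omega), max_eq_left (by omega), max_eq_left (by omega),
          max_eq_left (by omega)]
        ring_nf

theorem dsF_ch (n k : ℕ) : dsF (2 * n) (2 * k) = ch (2 * n) ((n : ℤ) - k) := by
  unfold ch
  split_ifs with h
  · rw [dsF_big _ _ (by push_cast; omega)]; rfl
  · rw [← dsF_choose]
    congr 1
    push_cast
    omega

/-- The number of pairs `(a, i)` where `a` is a Dyck path of length `2n` and `i` is a
position of a down-step of `a` from height `k` to height `k-1` equals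
`C(2n, n-k) - C(2n, n-k-1)`. -/
theorem card_down_steps (n k : ℕ) (hn : 1 ≤ n) (hk1 : 1 ≤ k) (hkn : k ≤ n) :
    Nat.card {p : {a : Fin (2 * n + 1) → ℤ // IsLatticePath n 0 a} × Fin (2 * n) //
        p.1.1 p.2.castSucc = (k : ℤ) ∧ p.1.1 p.2.succ = (k : ℤ) - 1} =
      ch (2 * n) ((n : ℤ) - k) - ch (2 * n) ((n : ℤ) - k - 1) := by
  have hm : ∀ a, a ∈ dsP (2 * n) 0 ↔ IsLatticePath n 0 a := fun a => mem_dsP (2 * n) 0 a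
  have key : (Nat.card {p : {a : Fin (2 * n + 1) → ℤ // IsLatticePath n 0 a} × Fin (2 * n) //
        p.1.1 p.2.castSucc = (k : ℤ) ∧ p.1.1 p.2.succ = (k : ℤ) - 1} : ℤ) =
      ∑ a ∈ dsP (2 * n) 0, dsC k (2 * n) a := by
    let T := ((dsP (2 * n) 0) ×ˢ (Finset.univ : Finset (Fin (2 * n)))).filter
      (fun p => p.1 p.2.castSucc = (k : ℤ) ∧ p.1 p.2.succ = (k : ℤ) - 1)
    have e : {p : {a : Fin (2 * n + 1) → ℤ // IsLatticePath n 0 a} × Fin (2 * n) //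
        p.1.1 p.2.castSucc = (k : ℤ) ∧ p.1.1 p.2.succ = (k : ℤ) - 1} ≃ T :=
      { toFun := fun p => ⟨(p.1.1.1, p.1.2), by
          simp only [T, Finset.mem_filter, Finset.mem_product, Finset.mem_univ, and_true, hm]
          exact ⟨p.1.1.2, p.2⟩⟩
        invFun := fun q => ⟨(⟨q.1.1, by
          have := q.2
          simp only [T, Finset.mem_filter, Finset.mem_product, Finset.mem_univ, and_true, hm] at this
          exact this.1⟩, q.1.2), by
          have := q.2
          simp only [T, Finset.mem_filter] at this
          exact this.2⟩
        left_inv := fun p => rfl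
        right_inv := fun q => rfl }
    rw [Nat.card_congr e, Nat.card_eq_fintype_card, Fintype.card_coe]
    simp only [T, dsC]
    rw [← Finset.sum_product', Finset.card_filter]
    push_cast
    rfl
  rw [sum_dsC k (by omega) _ 0 le_rfl, max_eq_right (by omega)] at key
  have h1 := dsF_ch n k
  have h2 := dsF_ch n (k + 1)
  push_cast at h2
  rw [show (n : ℤ) - (k + 1) = n - k - 1 by ring] at h2
  rw [show 2 * (k : ℤ) - 0 = 2 * k by ring, show 0 + 2 * (k : ℤ) + 2 = 2 * (k + 1) by ring,
    h1, h2] at key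
  omega
end

section
/- Fix integers n ≥ 1 and 0 ≤ k ≤ n. The number of nonnegative lattice paths of length 2n from 0 to 2k, i.e. the cardinality of 𝒟_(2n,2k), equals C(2n, n−k) − C(2n, n−k−1). -/
/-- paths of length `m` -/
def pathSet (m : ℕ) (h : ℤ) : Set (Fin (m + 1) → ℤ) :=
  {a | a 0 = 0 ∧ a (Fin.last m) = h ∧ (∀ i, 0 ≤ a i) ∧
    ∀ i : Fin m, a i.succ - a i.castSucc = 1 ∨ a i.succ - a i.castSucc = -1}

theorem pathSet_neg (m : ℕ) (h : ℤ) (hh : h < 0) : pathSet m h = ∅ := by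
  ext a
  simp only [pathSet, Set.mem_setOf_eq, Set.mem_empty_iff_false, iff_false]
  rintro ⟨_, h1, h2, _⟩
  have := h2 (Fin.last m)
  omega

theorem pathSet_zero (h : ℤ) : pathSet 0 h = if h = 0 then {fun _ => 0} else ∅ := by
  ext a
  split_ifs with hh
  · subst hh
    simp only [pathSet, Set.mem_setOf_eq, Set.mem_singleton_iff]
    constructor
    · rintro ⟨h0, _⟩
      funext i
      rw [show i = 0 from Fin.ext (by have := i.isLt; simp only [Fin.val_zero]; omega), h0]
    · rintro rfl
      exact ⟨rfl, rfl, fun _ => le_rfl, fun i => i.elim0⟩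
  · simp only [pathSet, Set.mem_setOf_eq, Set.mem_empty_iff_false, iff_false]
    rintro ⟨h0, h1, _⟩
    apply hh
    rw [← h1, ← h0]
    rfl

theorem pathSet_succ (m : ℕ) (h : ℤ) (hh : 0 ≤ h) :
    pathSet (m + 1) h = (fun a : Fin (m + 1) → ℤ => (Fin.snoc a h : Fin (m + 2) → ℤ)) ''
      (pathSet m (h - 1) ∪ pathSet m (h + 1)) := by
  ext a
  constructor
  · rintro ⟨h0, h1, h2, h3⟩
    refine ⟨Fin.init a, ?_, ?_⟩
    · have key : ∀ x, Fin.init a (Fin.last m) = x → Fin.init a ∈ pathSet m x := by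
        intro x hx
        refine ⟨h0, hx, fun i => h2 _, fun i => ?_⟩
        have := h3 i.castSucc
        simpa [Fin.init] using this
      have h4 := h3 (Fin.last m)
      rw [Fin.succ_last, h1] at h4
      rcases h4 with h4 | h4
      · left
        apply key
        simp only [Fin.init]
        omega
      · right
        apply key
        simp only [Fin.init]
        omega
    · simp only
      rw [← h1]
      exact Fin.snoc_init_self a
  · rintro ⟨b, hb, rfl⟩
    have hb' : b 0 = 0 ∧ (b (Fin.last m) = h - 1 ∨ b (Fin.last m) = h + 1) ∧ (∀ i, 0 ≤ b i) ∧
        ∀ i : Fin m, b i.succ - b i.castSucc = 1 ∨ b i.succ - b i.castSucc = -1 := by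
      rcases hb with ⟨p, q, r, s⟩ | ⟨p, q, r, s⟩
      · exact ⟨p, Or.inl q, r, s⟩
      · exact ⟨p, Or.inr q, r, s⟩
    obtain ⟨p, q, r, s⟩ := hb'
    refine ⟨?_, ?_, ?_, ?_⟩
    · have : (0 : Fin (m + 2)) = Fin.castSucc 0 := rfl
      simp only [this, Fin.snoc_castSucc, p]
    · simp
    · intro i
      refine Fin.lastCases ?_ (fun j => ?_) i
      · simpa using hh
      · simpa using r j
    · intro i
      refine Fin.lastCases ?_ (fun j => ?_) i
      · simp only [Fin.succ_last, Fin.snoc_last, Fin.snoc_castSucc]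
        omega
      · simp only [Fin.succ_castSucc, Fin.snoc_castSucc]
        exact s j

theorem ch_pascal (m : ℕ) (r : ℤ) : ch (m + 1) r = ch m r + ch m (r - 1) := by
  unfold ch
  rcases lt_trichotomy r 0 with h | h | h
  · rw [if_pos h, if_pos h, if_pos (by omega)]
  · subst h
    simp
  · rw [if_neg (by omega), if_neg (by omega), if_neg (by omega)]
    obtain ⟨t, rfl⟩ : ∃ t : ℕ, r = t + 1 := ⟨(r - 1).toNat, by omega⟩
    have : ((t : ℤ) + 1).toNat = t + 1 := by omega
    rw [this]
    have : ((t : ℤ) + 1 - 1).toNat = t := by omega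
    rw [this, Nat.choose_succ_succ, add_comm]

theorem pathSet_card (m : ℕ) : ∀ r : ℤ, -1 ≤ (m : ℤ) - 2 * r →
    (pathSet m (m - 2 * r)).Finite ∧
      (pathSet m (m - 2 * r)).ncard + ch m (r - 1) = ch m r := by
  induction m with
  | zero =>
    intro r hr
    rw [pathSet_zero]
    push_cast at *
    rcases eq_or_ne r 0 with h | h
    · subst h
      simp [ch]
    · rw [if_neg (by omega)]
      simp [ch, show r < 0 by omega, show r < 1 by omega]
  | succ m ih =>
    intro r hr
    push_cast at *
    by_cases h : 0 ≤ (m : ℤ) + 1 - 2 * r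
    · rw [pathSet_succ _ _ h]
      obtain ⟨f1, c1⟩ := ih r (by omega)
      obtain ⟨f2, c2⟩ := ih (r - 1) (by omega)
      rw [show (m : ℤ) + 1 - 2 * r - 1 = m - 2 * r by ring,
        show (m : ℤ) + 1 - 2 * r + 1 = m - 2 * (r - 1) by ring]
      refine ⟨(f1.union f2).image _, ?_⟩
      rw [Set.ncard_image_of_injective, Set.ncard_union_eq _ f1 f2, ch_pascal, ch_pascal]
      · omega
      · rw [Set.disjoint_left]
        rintro a ⟨_, h1, _⟩ ⟨_, h2, _⟩
        omega
      · intro a b hab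
        have := congrArg Fin.init hab
        simpa using this
    · rw [pathSet_neg _ _ (by omega)]
      refine ⟨Set.finite_empty, ?_⟩
      obtain ⟨t, rfl⟩ : ∃ t : ℕ, r = t + 1 := ⟨(r - 1).toNat, by omega⟩
      have hm : m = 2 * t := by omega
      subst hm
      rw [Set.ncard_empty, zero_add]
      unfold ch
      rw [if_neg (by omega), if_neg (by omega)]
      have : ((t : ℤ) + 1).toNat = t + 1 := by omega
      rw [this]
      have : ((t : ℤ) + 1 - 1).toNat = t := by omega
      rw [this]
      exact Nat.choose_symm_of_eq_add (by omega)

/-- The number of nonnegative lattice paths of length `2n` from `0` to `2k` equals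
`C(2n, n-k) - C(2n, n-k-1)`. -/
theorem card_lattice_paths (n k : ℕ) (hn : 1 ≤ n) (hkn : k ≤ n) :
    Nat.card {a : Fin (2 * n + 1) → ℤ // IsLatticePath n (2 * k) a} =
      ch (2 * n) ((n : ℤ) - k) - ch (2 * n) ((n : ℤ) - k - 1) := by
  have h := (pathSet_card (2 * n) ((n : ℤ) - k) (by push_cast; omega)).2
  have e : ((2 * n : ℕ) : ℤ) - 2 * ((n : ℤ) - k) = 2 * k := by push_cast; ring
  rw [e] at h
  have h2 : Nat.card {a : Fin (2 * n + 1) → ℤ // IsLatticePath n (2 * k) a} =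
      (pathSet (2 * n) (2 * k)).ncard := rfl
  omega
end

section
/- Fix integers n ≥ 1 and 1 ≤ k ≤ n. There is a bijection between the set 𝒮_k of pairs (a, i), where a ∈ 𝒟_(2n,0) is a Dyck path of length 2n and i ∈ {0,…,2n−1} satisfies a(i) = k and a(i+1) = k−1, and the set 𝒟_(2n,2k) of nonnegative lattice paths of length 2n from 0 to 2k; in particular the two sets have the same cardinality. -/
def reflIdx (n : ℕ) (i : Fin (2 * n)) (j : Fin (2 * n + 1)) : Fin (2 * n + 1) :=
  if h : j.1 ≤ i.1 then j else ⟨2 * n + i.1 + 1 - j.1, by omega⟩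

lemma reflIdx_le {n : ℕ} {i : Fin (2 * n)} {j : Fin (2 * n + 1)} (h : j.1 ≤ i.1) :
    reflIdx n i j = j := by simp [reflIdx, h]

lemma reflIdx_gt {n : ℕ} {i : Fin (2 * n)} {j : Fin (2 * n + 1)} (h : ¬ j.1 ≤ i.1) :
    (reflIdx n i j).1 = 2 * n + i.1 + 1 - j.1 := by simp [reflIdx, h]

lemma reflIdx_invol {n : ℕ} (i : Fin (2 * n)) (j : Fin (2 * n + 1)) :
    reflIdx n i (reflIdx n i j) = j := by
  by_cases h : j.1 ≤ i.1
  · rw [reflIdx_le h, reflIdx_le h]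
  · have h1 := reflIdx_gt h
    have h2 : ¬ (reflIdx n i j).1 ≤ i.1 := by omega
    apply Fin.ext
    rw [reflIdx_gt h2, h1]
    omega

def glue (n : ℕ) (c : ℤ) (a : Fin (2 * n + 1) → ℤ) (i : Fin (2 * n)) :
    Fin (2 * n + 1) → ℤ :=
  fun j => a (reflIdx n i j) + if j.1 ≤ i.1 then 0 else c

lemma glue_le {n : ℕ} {c : ℤ} {a : Fin (2 * n + 1) → ℤ} {i : Fin (2 * n)}
    {j : Fin (2 * n + 1)} (h : j.1 ≤ i.1) : glue n c a i j = a j := by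
  simp [glue, reflIdx_le h, h]

lemma glue_gt {n : ℕ} {c : ℤ} {a : Fin (2 * n + 1) → ℤ} {i : Fin (2 * n)}
    {j m : Fin (2 * n + 1)} (h : ¬ j.1 ≤ i.1) (hm : m.1 + j.1 = 2 * n + i.1 + 1) :
    glue n c a i j = a m + c := by
  have : reflIdx n i j = m := by
    apply Fin.ext
    rw [reflIdx_gt h]
    omega
  simp [glue, this, h]

lemma glue_glue {n : ℕ} {c : ℤ} {a : Fin (2 * n + 1) → ℤ} {i : Fin (2 * n)} :
    glue n c (glue n (-c) a i) i = a := by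
  funext j
  by_cases h : j.1 ≤ i.1
  · rw [glue_le h, glue_le h]
  · have h1 := reflIdx_gt h
    have h2 : ¬ (reflIdx n i j).1 ≤ i.1 := by omega
    simp [glue, reflIdx_invol, h, h2]

/-- steps of a glued path -/
lemma glue_step {n : ℕ} {c : ℤ} {a : Fin (2 * n + 1) → ℤ} {i : Fin (2 * n)}
    (hs : ∀ j : Fin (2 * n), a j.succ - a j.castSucc = 1 ∨ a j.succ - a j.castSucc = -1)
    (hi : a (Fin.last (2 * n)) + c - a i.castSucc = 1 ∨
      a (Fin.last (2 * n)) + c - a i.castSucc = -1) (j : Fin (2 * n)) :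
    glue n c a i j.succ - glue n c a i j.castSucc = 1 ∨
      glue n c a i j.succ - glue n c a i j.castSucc = -1 := by
  rcases lt_trichotomy j.1 i.1 with h | h | h
  · rw [glue_le (by simp; omega), glue_le (by simp; omega)]
    exact hs j
  · have : j = i := Fin.ext h
    subst this
    rw [glue_gt (m := Fin.last (2 * n)) (by simp) (by simp; omega), glue_le (by simp)]
    exact hi
  · let m : Fin (2 * n) := ⟨2 * n + i.1 - j.1, by omega⟩
    rw [glue_gt (j := j.succ) (m := m.castSucc) (by simp; omega) (by simp [m]; omega),
      glue_gt (j := j.castSucc) (m := m.succ) (by simp; omega) (by simp [m]; omega)]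
    rcases hs m with h | h
    · right; linarith
    · left; linarith

lemma glue_last {n : ℕ} {c : ℤ} {a : Fin (2 * n + 1) → ℤ} {i : Fin (2 * n)} :
    glue n c a i (Fin.last _) = a i.succ + c :=
  glue_gt (by simp) (by simp; omega)

lemma glue_zero {n : ℕ} {c : ℤ} {a : Fin (2 * n + 1) → ℤ} {i : Fin (2 * n)} :
    glue n c a i 0 = a 0 := glue_le (by simp)

lemma glue_succ {n : ℕ} {c : ℤ} {a : Fin (2 * n + 1) → ℤ} {i : Fin (2 * n)} :
    glue n c a i i.succ = a (Fin.last _) + c :=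
  glue_gt (by simp) (by simp; omega)

lemma glue_gt_ge {n : ℕ} {c : ℤ} {a : Fin (2 * n + 1) → ℤ} {i : Fin (2 * n)}
    (ha : ∀ j, 0 ≤ a j) {j : Fin (2 * n + 1)} (h : i.1 < j.1) : c ≤ glue n c a i j := by
  have := ha (reflIdx n i j)
  simp [glue, not_le.2 h, this]

lemma glue_path {n k : ℕ} {a : Fin (2 * n + 1) → ℤ} {i : Fin (2 * n)}
    (ha : IsLatticePath n 0 a) (h1 : a i.castSucc = (k : ℤ)) (h2 : a i.succ = (k : ℤ) - 1) :
    IsLatticePath n (2 * k) (glue n (k + 1) a i) := by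
  obtain ⟨h0, hl, hp, hs⟩ := ha
  refine ⟨by rw [glue_zero, h0], by rw [glue_last, h2]; ring, fun j => ?_, glue_step hs ?_⟩
  · by_cases h : j.1 ≤ i.1
    · rw [glue_le h]; exact hp j
    · have := glue_gt_ge (c := (k : ℤ) + 1) hp (not_le.1 h)
      omega
  · left; rw [hl, h1]; ring

lemma exists_last {n k : ℕ} {b : Fin (2 * n + 1) → ℤ} (hk1 : 1 ≤ k)
    (hb : IsLatticePath n (2 * k) b) :
    ∃ i : Fin (2 * n), b i.castSucc = k ∧ b i.succ = k + 1 ∧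
      ∀ j : Fin (2 * n + 1), i.1 < j.1 → (k : ℤ) + 1 ≤ b j := by
  obtain ⟨h0, hl, hp, hs⟩ := hb
  have hne : (Finset.univ.filter fun j => b j ≤ (k : ℤ)).Nonempty := ⟨0, by simp [h0]⟩
  obtain ⟨m, hm⟩ : ∃ m, m = (Finset.univ.filter fun j => b j ≤ (k : ℤ)).max' hne := ⟨_, rfl⟩
  have hmk : b m ≤ k := by
    have := Finset.max'_mem _ hne
    rw [← hm] at this
    simpa using this
  have hgt : ∀ j : Fin (2 * n + 1), m < j → (k : ℤ) + 1 ≤ b j := by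
    intro j hj
    by_contra hc
    have : j ≤ m := by
      rw [hm]
      exact Finset.le_max' _ _ (by simp; omega)
    exact absurd hj (not_lt.2 this)
  have hml : m ≠ Fin.last _ := by
    rintro rfl
    omega
  obtain ⟨i, rfl⟩ := Fin.exists_castSucc_eq.2 hml
  have h1 := hgt i.succ (Fin.castSucc_lt_succ)
  have h2 := hs i
  exact ⟨i, by omega, by omega, fun j hj => hgt j hj⟩

lemma unglue_path {n k : ℕ} {b : Fin (2 * n + 1) → ℤ} {i : Fin (2 * n)}
    (hb : IsLatticePath n (2 * k) b) (h1 : b i.castSucc = (k : ℤ)) (h2 : b i.succ = (k : ℤ) + 1)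
    (h3 : ∀ j : Fin (2 * n + 1), i.1 < j.1 → (k : ℤ) + 1 ≤ b j) :
    IsLatticePath n 0 (glue n (-(k + 1)) b i) := by
  obtain ⟨h0, hl, hp, hs⟩ := hb
  refine ⟨by rw [glue_zero, h0], by rw [glue_last, h2]; ring, fun j => ?_, glue_step hs ?_⟩
  · by_cases h : j.1 ≤ i.1
    · rw [glue_le h]; exact hp j
    · have := h3 (reflIdx n i j) (by rw [reflIdx_gt h]; omega)
      simp only [glue, h, if_false]
      omega
  · right; rw [hl, h1]; ring

theorem down_steps_equiv_lattice_paths (n k : ℕ) (hn : 1 ≤ n) (hk1 : 1 ≤ k)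
    (hkn : k ≤ n) :
    Nonempty
      ({p : {a : Fin (2 * n + 1) → ℤ // IsLatticePath n 0 a} × Fin (2 * n) //
          p.1.1 p.2.castSucc = (k : ℤ) ∧ p.1.1 p.2.succ = (k : ℤ) - 1} ≃
        {a : Fin (2 * n + 1) → ℤ // IsLatticePath n (2 * k) a}) := by
  refine ⟨Equiv.ofBijective
    (fun p => ⟨glue n (k + 1) p.1.1.1 p.1.2, glue_path p.1.1.2 p.2.1 p.2.2⟩) ⟨?_, ?_⟩⟩
  · rintro ⟨⟨⟨a, ha⟩, i⟩, h1, h2⟩ ⟨⟨⟨a', ha'⟩, i'⟩, h1', h2'⟩ h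
    simp only [Subtype.mk.injEq] at h h1 h2 h1' h2'
    have e1 : glue n (k + 1) a i i.castSucc = k := by rw [glue_le (by simp), h1]
    have e2 : glue n (k + 1) a' i' i'.castSucc = k := by rw [glue_le (by simp), h1']
    have hii : i = i' := by
      rcases lt_trichotomy i.1 i'.1 with hl | hl | hl
      · have := glue_gt_ge (c := (k : ℤ) + 1) ha.2.2.1 (i := i) (j := i'.castSucc) hl
        rw [h] at this
        omega
      · exact Fin.ext hl
      · have := glue_gt_ge (c := (k : ℤ) + 1) ha'.2.2.1 (i := i') (j := i.castSucc) hl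
        rw [← h] at this
        omega
    subst hii
    have haa : a = a' := by
      have := congrArg (fun b => glue n (-(k + 1)) b i) h
      have g : ∀ x, glue n (-((k : ℤ) + 1)) (glue n (k + 1) x i) i = x := fun x => by
        have := glue_glue (c := -((k : ℤ) + 1)) (a := x) (i := i)
        rwa [neg_neg] at this
      simpa only [g] using this
    subst haa
    rfl
  · rintro ⟨b, hb⟩
    obtain ⟨i, h1, h2, h3⟩ := exists_last hk1 hb
    refine ⟨⟨⟨⟨_, unglue_path hb h1 h2 h3⟩, i⟩, ?_, ?_⟩, ?_⟩
    · simp only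
      rw [glue_le (by simp), h1]
    · simp only
      rw [glue_succ, hb.2.1]; ring
    · simp only [Subtype.mk.injEq]
      exact glue_glue
end

section
/- Let R be a commutative ring, let A be a unital associative R-algebra, let n ≥ 1, and let e_1, …, e_{n−1} ∈ A. If f and g are elements of A such that f·e_i = e_i·f = 0 and g·e_i = e_i·g = 0 for all 1 ≤ i ≤ n−1, such that f − 1 and g − 1 belong to the (non-unital) subalgebra of A generated by e_1, …, e_{n−1}, and such that f² = f and g² = g, then f = g. (This is the uniqueness assertion for the n-th Jones–Wenzl idempotent.) -/
/-- Uniqueness of the Jones–Wenzl idempotent: if `f` and `g` both annihilate all the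
`e_i`, differ from `1` by an element of the non-unital subalgebra generated by the
`e_i`, and are idempotent, then `f = g`. -/
theorem jones_wenzl_unique {R A : Type*} [CommRing R] [Ring A] [Algebra R A]
    (n : ℕ) (hn : 1 ≤ n) (e : Fin (n - 1) → A) (f g : A)
    (hfe : ∀ i, f * e i = 0 ∧ e i * f = 0)
    (hge : ∀ i, g * e i = 0 ∧ e i * g = 0)
    (hf1 : f - 1 ∈ NonUnitalAlgebra.adjoin R (Set.range e))
    (hg1 : g - 1 ∈ NonUnitalAlgebra.adjoin R (Set.range e))
    (hf2 : f * f = f) (hg2 : g * g = g) : f = g := by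
  have h1 : ∀ x ∈ NonUnitalAlgebra.adjoin R (Set.range e), f * x = 0 ∧ x * g = 0 := by
    intro x hx
    induction hx using NonUnitalAlgebra.adjoin_induction with
    | mem x hx =>
      obtain ⟨i, rfl⟩ := hx
      exact ⟨(hfe i).1, (hge i).2⟩
    | add x y _ _ hx hy =>
      exact ⟨by rw [mul_add, hx.1, hy.1, add_zero], by rw [add_mul, hx.2, hy.2, add_zero]⟩
    | zero => exact ⟨mul_zero _, zero_mul _⟩
    | mul x y _ _ hx hy =>
      exact ⟨by rw [← mul_assoc, hx.1, zero_mul], by rw [mul_assoc, hy.2, mul_zero]⟩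
    | smul r x _ hx =>
      exact ⟨by rw [mul_smul_comm, hx.1, smul_zero], by rw [smul_mul_assoc, hx.2, smul_zero]⟩
  have a := (h1 _ hg1).1
  have b := (h1 _ hf1).2
  rw [mul_sub, mul_one, sub_eq_zero] at a
  rw [sub_mul, one_mul, sub_eq_zero] at b
  exact a.symm.trans b
end

section
/- Let R be a commutative ring, δ ∈ R, and n ≥ 1. Define Δ_0 = 1, Δ_1 = δ, Δ_{k+1} = δ·Δ_k − Δ_{k−1} in R, and assume Δ_1, …, Δ_{n−1} are units of R. Then in the Temperley–Lieb algebra TL_n(R,δ) there exists an element f (the n-th Jones–Wenzl idempotent) such that: (1) f·e_i = e_i·f = 0 for all 1 ≤ i ≤ n−1; (2) f − 1 belongs to the (non-unital) subalgebra generated by e_1, …, e_{n−1}; and (3) f² = f. -/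
/-- The defining relations of the Temperley–Lieb algebra `TL_n(R, δ)`:
`e_i² = δ e_i`; `e_i e_j e_i = e_i` when `|i - j| = 1`; `e_i e_j = e_j e_i` when
`|i - j| ≥ 2`. -/
inductive TLRel (R : Type*) [CommRing R] (δ : R) (n : ℕ) :
    FreeAlgebra R (Fin (n - 1)) → FreeAlgebra R (Fin (n - 1)) → Prop
  | sq (i : Fin (n - 1)) :
      TLRel R δ n (FreeAlgebra.ι R i * FreeAlgebra.ι R i) (δ • FreeAlgebra.ι R i)
  | braid (i j : Fin (n - 1)) (h : (i : ℕ) + 1 = j ∨ (j : ℕ) + 1 = i) :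
      TLRel R δ n (FreeAlgebra.ι R i * FreeAlgebra.ι R j * FreeAlgebra.ι R i)
        (FreeAlgebra.ι R i)
  | comm (i j : Fin (n - 1)) (h : (i : ℕ) + 2 ≤ j ∨ (j : ℕ) + 2 ≤ i) :
      TLRel R δ n (FreeAlgebra.ι R i * FreeAlgebra.ι R j)
        (FreeAlgebra.ι R j * FreeAlgebra.ι R i)

/-- The Temperley–Lieb algebra `TL_n(R, δ)`, presented by generators `e_1, …, e_{n-1}`
and the Temperley–Lieb relations. -/
abbrev TL (R : Type*) [CommRing R] (δ : R) (n : ℕ) : Type _ :=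
  RingQuot (TLRel R δ n)

/-- The generators `e_i` of the Temperley–Lieb algebra. -/
noncomputable def TLe (R : Type*) [CommRing R] (δ : R) (n : ℕ) (i : Fin (n - 1)) :
    TL R δ n :=
  RingQuot.mkAlgHom R (TLRel R δ n) (FreeAlgebra.ι R i)

/-- `Δ 0 = 1`, `Δ 1 = δ`, `Δ (k+2) = δ * Δ (k+1) - Δ k`. -/
def Del {R : Type*} [CommRing R] (δ : R) : ℕ → R
  | 0 => 1
  | 1 => δ
  | (k + 2) => δ * Del δ (k + 1) - Del δ k

theorem jw_aux {R A : Type*} [CommRing R] [Ring A] [Algebra R A] (δ : R) (N : ℕ) (e : ℕ → A)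
    (hsq : ∀ i < N, e i * e i = δ • e i)
    (hb : ∀ i, i + 1 < N → e (i + 1) * e i * e (i + 1) = e (i + 1))
    (hc : ∀ i j, i + 2 ≤ j → j < N → e i * e j = e j * e i)
    (S : NonUnitalSubalgebra R A) (hS : ∀ i < N, e i ∈ S)
    (hunit : ∀ k, 1 ≤ k → k ≤ N → IsUnit (Del δ k)) (m : ℕ) (hm : m ≤ N) :
    ∃ f : A, (∀ i < m, f * e i = 0 ∧ e i * f = 0) ∧ f * f = f ∧ f - 1 ∈ S ∧
      (∀ j, m + 1 ≤ j → j < N → f * e j = e j * f) ∧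
      (m < N → ∃ (g : A) (d : R), e m * f * e m = d • (e m * g) ∧ g * f = f ∧ f * g = f ∧
        e m * g = g * e m ∧ Del δ m * d = Del δ (m + 1)) := by
  induction m with
  | zero =>
    refine ⟨1, by simp, by simp, by simp, by simp, fun h => ⟨1, δ, ?_, by simp, by simp, by simp, ?_⟩⟩
    · simp [hsq 0 h]
    · simp [Del]
  | succ m ih =>
    obtain ⟨f, h0, hff, hfS, hcomm, hg⟩ := ih (by omega)
    obtain ⟨g, d, hefe, hgf, hfg, heg, hd⟩ := hg (by omega)
    obtain ⟨u, hu⟩ := hunit (m + 1) (by omega) hm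
    obtain ⟨c, hcdef⟩ : ∃ c : R, Del δ (m + 1) * c = Del δ m :=
      ⟨(↑u⁻¹ : R) * Del δ m, by rw [← hu, Units.mul_inv_cancel_left]⟩
    have hcd : c * d = 1 := by
      apply (hunit (m + 1) (by omega) hm).mul_left_cancel
      rw [← mul_assoc, hcdef, hd, mul_one]
    obtain ⟨F, hF⟩ : ∃ F, F = f - c • (f * e m * f) := ⟨_, rfl⟩
    have hfF : f * F = F := by
      rw [hF, mul_sub, mul_smul_comm, hff, ← mul_assoc, ← mul_assoc, hff]
    have hFf : F * f = F := by
      rw [hF, sub_mul, smul_mul_assoc, hff, mul_assoc _ f f, hff]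
    have heF : e m * F = 0 := by
      have : e m * (f * e m * f) = d • (e m * f) := by
        rw [← mul_assoc, ← mul_assoc, hefe, smul_mul_assoc, mul_assoc, hgf]
      rw [hF, mul_sub, mul_smul_comm, this, smul_smul, hcd, one_smul, sub_self]
    have hFe : F * e m = 0 := by
      have : f * e m * f * e m = d • (f * e m) := by
        rw [mul_assoc f, mul_assoc f, hefe, heg, mul_smul_comm, ← mul_assoc, hfg]
      rw [hF, sub_mul, smul_mul_assoc, this, smul_smul, hcd, one_smul, sub_self]
    refine ⟨F, ?_, ?_, ?_, ?_, ?_⟩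
    · intro i hi
      rcases Nat.lt_succ_iff_lt_or_eq.1 hi with h | rfl
      · constructor
        · rw [← hFf, mul_assoc, (h0 i h).1, mul_zero]
        · rw [← hfF, ← mul_assoc, (h0 i h).2, zero_mul]
      · exact ⟨hFe, heF⟩
    · have : F * F = (f - c • (f * e m * f)) * F := by rw [← hF]
      rw [this, sub_mul, smul_mul_assoc, mul_assoc _ f F, hfF, mul_assoc f, heF]
      simp
    · have he := hS m (by omega)
      have : F - 1 = (f - 1) - c • (e m + (f - 1) * e m + e m * (f - 1)
          + (f - 1) * e m * (f - 1)) := by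
        rw [hF]
        have : f * e m * f = e m + (f - 1) * e m + e m * (f - 1)
          + (f - 1) * e m * (f - 1) := by noncomm_ring
        rw [this]; abel
      rw [this]
      exact sub_mem hfS (S.smul_mem c (S.add_mem (S.add_mem (S.add_mem he (S.mul_mem hfS he))
        (S.mul_mem he hfS)) (S.mul_mem (S.mul_mem hfS he) hfS)))
    · intro j hj hjN
      have h1 : Commute f (e j) := hcomm j (by omega) hjN
      have h2 : Commute (e m) (e j) := hc m j (by omega) hjN
      rw [hF]
      exact (h1.sub_left (((h1.mul_left h2).mul_left h1).smul_left c)).eq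
    · intro hN
      have h1 := hcomm (m + 1) le_rfl hN
      refine ⟨f, δ - c, ?_, hfF, hFf, h1.symm, ?_⟩
      · have h2 : e (m + 1) * (f * e m * f) * e (m + 1) = e (m + 1) * f := by
          calc _ = (e (m + 1) * f) * e m * (f * e (m + 1)) := by noncomm_ring
            _ = f * (e (m + 1) * e m * e (m + 1)) * f := by
              rw [← h1, mul_assoc f, mul_assoc f, h1]
              simp only [mul_assoc]
            _ = _ := by rw [hb m hN, h1, mul_assoc, hff]
        have h3 : e (m + 1) * f * e (m + 1) = δ • (e (m + 1) * f) := by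
          rw [mul_assoc, h1, ← mul_assoc, hsq _ hN, smul_mul_assoc]
        rw [hF, mul_sub, sub_mul, mul_smul_comm, smul_mul_assoc, h2, h3, sub_smul]
      · rw [mul_sub, hcdef, Del]; ring

/-- Existence of the `n`-th Jones–Wenzl idempotent in `TL_n(R, δ)` when
`Δ_1, …, Δ_{n-1}` are units: it annihilates all the `e_i`, differs from `1` by an
element of the non-unital subalgebra generated by the `e_i`, and is idempotent. -/
theorem jones_wenzl_exists (R : Type*) [CommRing R] (δ : R) (n : ℕ) (hn : 1 ≤ n)
    (hunit : ∀ k, 1 ≤ k → k ≤ n - 1 → IsUnit (Del δ k)) :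
    ∃ f : TL R δ n,
      (∀ i, f * TLe R δ n i = 0 ∧ TLe R δ n i * f = 0) ∧
      f - 1 ∈ NonUnitalAlgebra.adjoin R (Set.range (TLe R δ n)) ∧
      f * f = f := by
  have hsq : ∀ i, TLe R δ n i * TLe R δ n i = δ • TLe R δ n i := fun i => by
    have := RingQuot.mkAlgHom_rel R (TLRel.sq (R := R) (δ := δ) (n := n) i)
    simpa [TLe] using this
  have hb : ∀ i j : Fin (n - 1), ((i : ℕ) + 1 = j ∨ (j : ℕ) + 1 = i) →
      TLe R δ n i * TLe R δ n j * TLe R δ n i = TLe R δ n i := fun i j h => by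
    have := RingQuot.mkAlgHom_rel R (TLRel.braid (R := R) (δ := δ) (n := n) i j h)
    simpa [TLe] using this
  have hc : ∀ i j : Fin (n - 1), ((i : ℕ) + 2 ≤ j ∨ (j : ℕ) + 2 ≤ i) →
      TLe R δ n i * TLe R δ n j = TLe R δ n j * TLe R δ n i := fun i j h => by
    have := RingQuot.mkAlgHom_rel R (TLRel.comm (R := R) (δ := δ) (n := n) i j h)
    simpa [TLe] using this
  obtain ⟨e, he⟩ : ∃ e : ℕ → TL R δ n, ∀ i (h : i < n - 1), e i = TLe R δ n ⟨i, h⟩ :=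
    ⟨fun i => if h : i < n - 1 then TLe R δ n ⟨i, h⟩ else 0, fun i h => by simp [h]⟩
  obtain ⟨f, h0, hff, hfS, -, -⟩ := jw_aux δ (n - 1) e
    (fun i h => by rw [he i h]; exact hsq _)
    (fun i h => by rw [he _ h, he i (by omega)]; exact hb _ _ (Or.inr rfl))
    (fun i j hij h => by rw [he _ h, he i (by omega)]; exact hc _ _ (Or.inl hij))
    (NonUnitalAlgebra.adjoin R (Set.range (TLe R δ n)))
    (fun i h => by rw [he i h]; exact NonUnitalAlgebra.subset_adjoin R ⟨_, rfl⟩)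
    hunit (n - 1) le_rfl
  refine ⟨f, fun i => ?_, hfS, hff⟩
  have := h0 i i.2
  rwa [he i i.2] at this
end

section
/- Fix an integer n ≥ 1 and let A ∈ ℂ be a primitive 4(n+1)-th root of unity. Set δ = −A² − A^{−2}. Then the Gram matrix (δ^{c(π,ρ)})_{π,ρ ∈ NC(n)} of Lickorish's bilinear form on the Temperley–Lieb algebra TL_n is singular, i.e. its determinant is 0. -/
/-- Noncrossing perfect matchings of the `2*n` points `{0, …, 2n-1}`:
fixed-point-free involutions of `Fin (2*n)` with no crossing
`a < b < c < d`, `π a = c`, `π b = d`. -/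
abbrev NCMatching (n : ℕ) : Type :=
  {π : Equiv.Perm (Fin (2 * n)) //
    (∀ v, π v ≠ v) ∧ (∀ v, π (π v) = v) ∧
      ∀ a b c d : Fin (2 * n), a < b → b < c → c < d → π a = c → π b = d → False}

/-- The number of connected components (closed loops) of the graph on `Fin (2*n)`
where distinct `v, w` are adjacent iff `π v = w` or `ρ v = w`. -/
noncomputable def loopCount (n : ℕ) (π ρ : Equiv.Perm (Fin (2 * n))) : ℕ :=
  Nat.card (SimpleGraph.fromRel fun v w => π v = w ∨ ρ v = w).ConnectedComponent

structure NCP (N : ℕ) (p : ℕ → ℕ) : Prop where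
  lt : ∀ x, x < N → p x < N
  ne : ∀ x, x < N → p x ≠ x
  inv : ∀ x, x < N → p (p x) = x
  nc : ∀ a b, a < N → b < N → a < b → b < p a → a < p b ∧ p b < p a

def ee (i x : ℕ) : ℕ := if x < i then x else x + 2
def dd (i x : ℕ) : ℕ := if x < i then x else x - 2
def del (i : ℕ) (p : ℕ → ℕ) (x : ℕ) : ℕ :=
  dd i (if p (ee i x) = i then p (i+1) else if p (ee i x) = i + 1 then p i else p (ee i x))

theorem ee_lt {i x y : ℕ} : ee i x < ee i y ↔ x < y := by
  unfold ee; split_ifs <;> omega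
theorem ee_inj {i x y : ℕ} : ee i x = ee i y ↔ x = y := by
  unfold ee; split_ifs <;> omega
theorem ee_ne (i x : ℕ) : ee i x ≠ i ∧ ee i x ≠ i + 1 := by
  unfold ee; split_ifs <;> omega
theorem ee_bd {N i x : ℕ} (h : x < N) : ee i x < N + 2 := by
  unfold ee; split_ifs <;> omega
theorem ee_dd {i z : ℕ} (h : z ≠ i) (h' : z ≠ i + 1) : ee i (dd i z) = z := by
  unfold ee dd; split_ifs <;> omega
theorem dd_bd {N i z : ℕ} (hi : i ≤ N) (hz : z < N + 2) (h : z ≠ i) (h' : z ≠ i + 1) :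
    dd i z < N := by
  unfold dd; split_ifs <;> omega
theorem dd_ee (i x : ℕ) : dd i (ee i x) = x := by
  unfold ee dd; split_ifs <;> omega

theorem del_spec {N i : ℕ} {p : ℕ → ℕ} (hp : NCP (N + 2) p) (hi : i ≤ N) {x : ℕ} (hx : x < N) :
    del i p x < N ∧
    ((ee i (del i p x) = p (ee i x) ∧ p (ee i x) ≠ i ∧ p (ee i x) ≠ i + 1) ∨
     (p i ≠ i + 1 ∧ ee i x = p i ∧ ee i (del i p x) = p (i + 1)) ∨
     (p i ≠ i + 1 ∧ ee i x = p (i + 1) ∧ ee i (del i p x) = p i)) := by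
  have hb := ee_bd (i := i) hx
  have hne := ee_ne i x
  have h1 := hp.inv _ hb
  have h2 := hp.inv i (by omega)
  have h3 := hp.inv (i+1) (by omega)
  have h4 := hp.ne i (by omega)
  have h5 := hp.ne (i+1) (by omega)
  have h6 := hp.lt _ hb
  have h7 := hp.lt i (by omega)
  have h8 := hp.lt (i+1) (by omega)
  unfold del
  split_ifs with c1 c2
  · have a1 : p (i+1) ≠ i := by grind
    refine ⟨dd_bd hi h8 a1 h5, ?_⟩
    rw [ee_dd a1 h5]
    grind
  · have a1 : p i ≠ i + 1 := by grind
    refine ⟨dd_bd hi h7 h4 a1, ?_⟩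
    rw [ee_dd h4 a1]
    grind
  · refine ⟨dd_bd hi h6 c1 c2, ?_⟩
    rw [ee_dd c1 c2]
    grind

theorem new_nc {M i : ℕ} {p : ℕ → ℕ} (hp : NCP M p) (hi : i + 1 < M) (hne : p i ≠ i + 1)
    {a b c d : ℕ} (hac : (a = p i ∧ c = p (i+1)) ∨ (a = p (i+1) ∧ c = p i))
    (hb : b < M) (hab : a < b) (hbc : b < c) (hbi : b ≠ i ∧ b ≠ i + 1)
    (hd : (d = p b ∧ p b ≠ i ∧ p b ≠ i + 1) ∨ (p i ≠ i + 1 ∧ b = p i ∧ d = p (i + 1)) ∨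
     (p i ≠ i + 1 ∧ b = p (i + 1) ∧ d = p i)) : a < d ∧ d < c := by
  have h2 := hp.inv i (by omega)
  have h3 := hp.inv (i+1) (by omega)
  have h7 := hp.lt i (by omega)
  have h8 := hp.lt (i+1) (by omega)
  have hn1 := hp.ne i (by omega)
  have hn2 := hp.ne (i+1) (by omega)
  have hib := hp.inv b hb
  have hlb := hp.lt b hb
  have hd : d = p b := by omega
  have hbj : b ≠ p i := by omega
  have hbk : b ≠ p (i+1) := by omega
  have hdj : d ≠ p i := by rintro rfl; rw [← hd, h2] at hib; omega
  have hdk : d ≠ p (i+1) := by rintro rfl; rw [← hd, h3] at hib; omega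
  have hne' : p (i+1) ≠ i := by grind
  have q1 := hp.nc i (i+1) (by omega) (by omega)
  have q2 := hp.nc (p i) (i+1) h7 hi
  have q3 := hp.nc (p (i+1)) i h8 (by omega)
  have q6 := hp.nc i b (by omega) hb
  have q7 := hp.nc (i+1) b hi hb
  have q8 := hp.nc (p i) b h7 hb
  have q9 := hp.nc (p (i+1)) b h8 hb
  have q10 := hp.nc i (p b) (by omega) hlb
  have q11 := hp.nc (i+1) (p b) hi hlb
  have q12 := hp.nc (p i) (p b) h7 hlb
  have q13 := hp.nc (p (i+1)) (p b) h8 hlb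
  rw [h2] at q2 q8 q12
  rw [h3] at q3 q9 q13
  rw [hib] at q10 q11 q12 q13
  rw [← hd] at *
  clear hp
  generalize p i = j at *
  generalize p (i+1) = k at *
  omega

theorem del_ncp {N i : ℕ} {p : ℕ → ℕ} (hp : NCP (N + 2) p) (hi : i ≤ N) : NCP N (del i p) := by
  have h2 := hp.inv i (by omega)
  have h3 := hp.inv (i+1) (by omega)
  have h7 := hp.lt i (by omega)
  have h8 := hp.lt (i+1) (by omega)
  have hn1 := hp.ne i (by omega)
  have hn2 := hp.ne (i+1) (by omega)
  have hlt : ∀ x, x < N → del i p x < N := fun x hx => (del_spec hp hi hx).1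
  refine ⟨hlt, ?_, ?_, ?_⟩
  · intro x hx h
    have hs := (del_spec hp hi hx).2
    rw [h] at hs
    have := hp.ne _ (ee_bd (i := i) hx)
    grind
  · intro x hx
    have hs := (del_spec hp hi hx).2
    have hs' := (del_spec hp hi (hlt x hx)).2
    have := hp.inv _ (ee_bd (i := i) hx)
    have := ee_ne i x
    have := ee_ne i (del i p x)
    rw [← ee_inj (i := i)]
    grind
  · intro a b ha hb hab hba
    have hsa := (del_spec hp hi ha).2
    have hsb := (del_spec hp hi hb).2
    have hsa0 := ee_bd (i := i) ha
    have hsb0 := ee_bd (i := i) hb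
    rw [← ee_lt (i := i)] at hab hba ⊢
    rw [← ee_lt (i := i) (y := del i p a)]
    have e1 := ee_ne i a
    have e2 := ee_ne i b
    have e3 := ee_ne i (del i p a)
    have e4 := ee_ne i (del i p b)
    generalize ee i a = a' at *
    generalize ee i b = b' at *
    generalize ee i (del i p a) = c' at *
    generalize ee i (del i p b) = d' at *
    have key := hp.nc
    have ia := hp.inv a' hsa0
    have ib := hp.inv b' hsb0
    have la := hp.lt a' hsa0
    have lb := hp.lt b' hsb0
    have k1 := key a' b' hsa0 hsb0
    rcases hsa with ⟨s1, s2, s3⟩ | ⟨s1, s2, s3⟩ | ⟨s1, s2, s3⟩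
    · have k2 := key a' i hsa0 (by omega)
      have k3 := key a' (i+1) hsa0 (by omega)
      rcases hsb with ⟨t1, t2, t3⟩ | ⟨t1, t2, t3⟩ | ⟨t1, t2, t3⟩
      · omega
      · rw [t2, h2] at k1
        omega
      · rw [t2, h3] at k1
        omega
    · exact new_nc hp (by omega) s1 (Or.inl ⟨s2, s3⟩) hsb0 hab hba e2 hsb
    · exact new_nc hp (by omega) s1 (Or.inr ⟨s2, s3⟩) hsb0 hab hba e2 hsb

theorem short_arc {N : ℕ} {r : ℕ → ℕ} (hr : NCP N r) (hN : 0 < N) : ∃ i, i + 1 < N ∧ r i = i + 1 := by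
  have key : ∀ d a, a < N → a < r a → r a - a ≤ d → ∃ i, i + 1 < N ∧ r i = i + 1 := by
    intro d
    induction d with
    | zero => intro a _ _ _; omega
    | succ d ih =>
      intro a ha hra hd
      have hl := hr.lt a ha
      by_cases h : r a = a + 1
      · exact ⟨a, by omega, h⟩
      have h1 := hr.nc a (a+1) ha (by omega) (by omega) (by omega)
      have h2 := hr.ne (a+1) (by omega)
      exact ih (a+1) (by omega) (by omega) (by omega)
  have := hr.ne 0 hN
  exact key _ 0 hN (by omega) le_rfl

theorem prod_split (F : ℕ → ℂ) {N i : ℕ} (hi : i ≤ N) :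
    ∏ a ∈ Finset.range (N + 2), F a = F i * F (i+1) * ∏ y ∈ Finset.range N, F (ee i y) := by
  obtain ⟨m, rfl⟩ := Nat.exists_eq_add_of_le hi
  rw [show i + m + 2 = i + (m + 2) by ring, Finset.prod_range_add,
    Finset.prod_range_add (fun y => F (ee i y)), Finset.prod_range_succ', Finset.prod_range_succ']
  have h1 : ∏ x ∈ Finset.range i, F (ee i x) = ∏ x ∈ Finset.range i, F x := by
    apply Finset.prod_congr rfl
    intro x hx
    simp [ee, Finset.mem_range.1 hx]
  have h2 : ∏ x ∈ Finset.range m, F (ee i (i + x)) = ∏ x ∈ Finset.range m, F (i + (x + 1 + 1)) := by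
    apply Finset.prod_congr rfl
    intro x hx
    simp [ee, add_assoc]
  rw [h1, h2]
  simp
  ring

noncomputable def cnt (N : ℕ) (p r : ℕ → ℕ) : ℕ :=
  Nat.card (Quot (fun x y : Fin N => p x = y ∨ r x = y))

theorem card_quot {X Y : Type} {r : X → X → Prop} {s : Y → Y → Prop} (f : X → Y) (g : Y → X)
    (hf : ∀ x x', r x x' → Quot.mk s (f x) = Quot.mk s (f x'))
    (hg : ∀ x x', s x x' → Quot.mk r (g x) = Quot.mk r (g x'))
    (hgf : ∀ x, Quot.mk r (g (f x)) = Quot.mk r x)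
    (hfg : ∀ x, Quot.mk s (f (g x)) = Quot.mk s x) :
    Nat.card (Quot r) = Nat.card (Quot s) :=
  Nat.card_congr
    { toFun := Quot.lift (fun x => Quot.mk s (f x)) hf
      invFun := Quot.lift (fun x => Quot.mk r (g x)) hg
      left_inv := by rintro ⟨x⟩; exact hgf x
      right_inv := by rintro ⟨x⟩; exact hfg x }

/-- no new arc when `r i = i+1` -/
theorem del_specA {N i : ℕ} {p : ℕ → ℕ} (hp : NCP (N + 2) p) (hi : i ≤ N) (h : p i = i + 1)
    {x : ℕ} (hx : x < N) : del i p x < N ∧ ee i (del i p x) = p (ee i x) := by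
  have := del_spec hp hi hx
  grind

theorem cntA {N i : ℕ} {p r : ℕ → ℕ} (hp : NCP (N + 2) p) (hr : NCP (N + 2) r) (hi : i ≤ N)
    (h : r i = i + 1) (hpi : p i = i + 1) : cnt (N + 2) p r = cnt N (del i p) (del i r) + 1 := by
  unfold cnt
  have h' : r (i+1) = i := by rw [← h]; exact hr.inv i (by omega)
  have hpi' : p (i+1) = i := by rw [← hpi]; exact hp.inv i (by omega)
  rw [← Finite.card_option]
  let R := (fun x y : Fin (N+2) => p x = y ∨ r x = y)
  let S := (fun x y : Fin N => del i p x = y ∨ del i r x = y)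
  let f : Fin (N+2) → Option (Quot S) := fun z =>
    if hz : z.1 ≠ i ∧ z.1 ≠ i + 1 then some (Quot.mk S ⟨dd i z, dd_bd hi z.2 hz.1 hz.2⟩) else none
  have fe : ∀ y : Fin N, f ⟨ee i y, ee_bd y.2⟩ = some (Quot.mk S y) := by
    intro y
    simp only [f]
    rw [dif_pos (ee_ne i y)]
    congr 2
    ext; exact dd_ee i y
  have ex : ∀ z : Fin (N+2), (z.1 = i ∨ z.1 = i + 1) ∨ ∃ y : Fin N, z = ⟨ee i y, ee_bd y.2⟩ := by
    intro z
    by_cases hz : z.1 ≠ i ∧ z.1 ≠ i + 1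
    · right; exact ⟨⟨dd i z, dd_bd hi z.2 hz.1 hz.2⟩, by ext; exact (ee_dd hz.1 hz.2).symm⟩
    · left; tauto
  have hf : ∀ x x', R x x' → f x = f x' := by
    intro x x' hx
    rcases ex x with hz | ⟨y, rfl⟩
    · have : x'.1 = i ∨ x'.1 = i + 1 := by
        simp only [R] at hx
        grind
      simp only [f]
      rw [dif_neg (by tauto), dif_neg (by tauto)]
    · have a1 := del_specA hp hi hpi y.2
      have a2 := del_specA hr hi h y.2
      rcases hx with hx | hx
      · have : x' = ⟨ee i (⟨del i p y, a1.1⟩ : Fin N), ee_bd a1.1⟩ := by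
          ext; simp only [a1.2]; exact hx.symm
        rw [this, fe, fe]
        exact congrArg some (Quot.sound (Or.inl rfl))
      · have : x' = ⟨ee i (⟨del i r y, a2.1⟩ : Fin N), ee_bd a2.1⟩ := by
          ext; simp only [a2.2]; exact hx.symm
        rw [this, fe, fe]
        exact congrArg some (Quot.sound (Or.inr rfl))
  have hg : ∀ y y' : Fin N, S y y' → Quot.mk R ⟨ee i y, ee_bd y.2⟩ = Quot.mk R ⟨ee i y', ee_bd y'.2⟩ := by
    intro y y' hy
    have a1 := del_specA hp hi hpi y.2
    have a2 := del_specA hr hi h y.2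
    apply Quot.sound
    rcases hy with hy | hy
    · left; simp only; rw [← a1.2, hy]
    · right; simp only; rw [← a2.2, hy]
  exact Nat.card_congr
    { toFun := Quot.lift f hf
      invFun := fun o => o.elim (Quot.mk R ⟨i, by omega⟩)
        (Quot.lift (fun y => Quot.mk R ⟨ee i y, ee_bd y.2⟩) hg)
      left_inv := by
        rintro ⟨x⟩
        rcases ex x with hz | ⟨y, rfl⟩
        · have : f x = none := by simp only [f]; rw [dif_neg (by tauto)]
          simp only [this, Option.elim]
          rcases hz with hz | hz
          · congr 1; ext; exact hz.symm
          · apply Quot.sound; left; simp only [hpi, hz]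
        · simp only [fe, Option.elim]; rfl
      right_inv := by
        rintro (_ | ⟨⟨y⟩⟩)
        · simp [f]
        · simp only [Option.elim, fe]; rfl }

theorem cntB {N i : ℕ} {p r : ℕ → ℕ} (hp : NCP (N + 2) p) (hr : NCP (N + 2) r) (hi : i ≤ N)
    (h : r i = i + 1) (hpi : p i ≠ i + 1) : cnt (N + 2) p r = cnt N (del i p) (del i r) := by
  unfold cnt
  have h' : r (i+1) = i := by rw [← h]; exact hr.inv i (by omega)
  have b2 := hp.inv i (by omega)
  have b3 := hp.inv (i+1) (by omega)
  have b4 := hp.ne i (by omega)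
  have b5 := hp.ne (i+1) (by omega)
  have b7 := hp.lt i (by omega)
  have b8 := hp.lt (i+1) (by omega)
  have b9 : p (i+1) ≠ i := by grind
  have hj : ∃ j, j < N ∧ ee i j = p i := ⟨dd i (p i), dd_bd hi b7 b4 hpi, ee_dd b4 hpi⟩
  have hk : ∃ k, k < N ∧ ee i k = p (i+1) := ⟨dd i (p (i+1)), dd_bd hi b8 b9 b5, ee_dd b9 b5⟩
  obtain ⟨j, hjN, hj⟩ := hj
  obtain ⟨k, hkN, hk⟩ := hk
  have hkj : del i p k = j := by
    have := (del_spec hp hi hkN).2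
    rw [← ee_inj (i := i)]
    grind
  let R := (fun x y : Fin (N+2) => p x = y ∨ r x = y)
  let S := (fun x y : Fin N => del i p x = y ∨ del i r x = y)
  let f : Fin (N+2) → Fin N := fun z =>
    if hz : z.1 ≠ i ∧ z.1 ≠ i + 1 then ⟨dd i z, dd_bd hi z.2 hz.1 hz.2⟩ else ⟨j, hjN⟩
  let g : Fin N → Fin (N+2) := fun y => ⟨ee i y, ee_bd y.2⟩
  have fe : ∀ y : Fin N, f (g y) = y := by
    intro y
    simp only [f, g]
    rw [dif_pos (ee_ne i y)]
    ext; exact dd_ee i y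
  have fi : ∀ z : Fin (N+2), (z.1 = i ∨ z.1 = i + 1) → f z = ⟨j, hjN⟩ := by
    intro z hz
    simp only [f]; rw [dif_neg (by tauto)]
  have ex : ∀ z : Fin (N+2), (z.1 = i ∨ z.1 = i + 1) ∨ ∃ y : Fin N, z = g y := by
    intro z
    by_cases hz : z.1 ≠ i ∧ z.1 ≠ i + 1
    · right; exact ⟨⟨dd i z, dd_bd hi z.2 hz.1 hz.2⟩, by ext; exact (ee_dd hz.1 hz.2).symm⟩
    · left; tauto
  have skj : Quot.mk S ⟨k, hkN⟩ = Quot.mk S ⟨j, hjN⟩ := Quot.sound (Or.inl hkj)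
  have ri : Quot.mk R ⟨i, by omega⟩ = Quot.mk R ⟨i+1, by omega⟩ := Quot.sound (Or.inr h)
  have rj : Quot.mk R ⟨i, by omega⟩ = Quot.mk R (g ⟨j, hjN⟩) := Quot.sound (Or.inl hj.symm)
  have rk : Quot.mk R ⟨i+1, by omega⟩ = Quot.mk R (g ⟨k, hkN⟩) := Quot.sound (Or.inl hk.symm)
  refine card_quot f g ?_ ?_ ?_ ?_
  · intro x x' hx
    change Quot.mk S _ = Quot.mk S _
    rcases ex x with hz | ⟨y, rfl⟩
    · rw [fi x hz]
      rcases ex x' with hz' | ⟨y', rfl⟩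
      · rw [fi x' hz']
      · rw [fe]
        have e1 := ee_ne i y'
        have : y'.1 = j ∨ y'.1 = k := by
          rw [← ee_inj (i := i), ← ee_inj (i := i) (y := k), hj, hk]
          simp only [g] at hx
          grind
        rcases this with e | e
        · congr 1; ext; exact e.symm
        · rw [← skj]; congr 1; ext; exact e.symm
    · rw [fe]
      have a1 := del_spec hp hi y.2
      have a2 := del_specA hr hi h y.2
      have e0 := hp.inv _ (ee_bd (i := i) y.2)
      rcases hx with hx | hx
      · rcases ex x' with hz' | ⟨y', rfl⟩
        · rw [fi x' hz']
          have : y.1 = j ∨ y.1 = k := by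
            rw [← ee_inj (i := i), ← ee_inj (i := i) (y := k), hj, hk]
            simp only [g] at hx
            grind
          rcases this with e | e
          · congr 1; ext; exact e
          · rw [← skj]; congr 1; ext; exact e
        · rw [fe]
          apply Quot.sound; left
          have e1 := ee_ne i y'
          have e2 := ee_ne i y
          rw [← ee_inj (i := i)]
          simp only [g] at hx
          grind
      · have : x' = g ⟨del i r y, a2.1⟩ := by
          ext; simp only [g, a2.2]; exact hx.symm
        rw [this, fe]
        exact Quot.sound (Or.inr rfl)
  · intro y y' hy
    change Quot.mk R _ = Quot.mk R _
    have a1 := (del_spec hp hi y.2).2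
    have a2 := del_specA hr hi h y.2
    rcases hy with hy | hy
    · rw [hy] at a1
      rcases a1 with ⟨s, _⟩ | ⟨_, s1, s2⟩ | ⟨_, s1, s2⟩
      · exact Quot.sound (Or.inl s.symm)
      · have e1 : y = ⟨j, hjN⟩ := by ext; simp only; rw [← ee_inj (i := i), s1, hj]
        have e2 : y' = ⟨k, hkN⟩ := by ext; simp only; rw [← ee_inj (i := i), s2, hk]
        rw [e1, e2, ← rj, ← rk, ri]
      · have e1 : y = ⟨k, hkN⟩ := by ext; simp only; rw [← ee_inj (i := i), s1, hk]
        have e2 : y' = ⟨j, hjN⟩ := by ext; simp only; rw [← ee_inj (i := i), s2, hj]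
        rw [e1, e2, ← rj, ← rk, ri]
    · apply Quot.sound
      right; simp only [g]; rw [← a2.2, hy]
  · intro x
    change Quot.mk R _ = Quot.mk R _
    rcases ex x with hz | ⟨y, rfl⟩
    · rw [fi x hz, ← rj]
      rcases hz with hz | hz
      · congr 1; ext; exact hz.symm
      · rw [ri]; congr 1; ext; exact hz.symm
    · rw [fe]
  · intro y
    rw [fe]

def Cond {V : Type} (adj : V → V → Prop) (base : V) (N : ℕ) (p : ℕ → ℕ) (w : ℕ → V) : Prop :=
  w 0 = base ∧ ∀ a, a < N → adj (w a) (w (a+1)) ∧ w (p a + 1) = w a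

open Classical in
noncomputable def phi {V : Type} (adj : V → V → Prop) (base : V) (μ : V → ℂ) (N : ℕ) (p : ℕ → ℕ)
    (w : ℕ → V) : ℂ :=
  if Cond adj base N p w then ∏ a ∈ Finset.range N, (if a < p a then μ (w (a+1)) else 1) else 0

def ins {V : Type} (i : ℕ) (w : ℕ → V) (b : V) (x : ℕ) : V :=
  if x ≤ i then w x else if x = i + 1 then b else w (x - 2)

noncomputable def cap {V : Type} [Fintype V] (μ : V → ℂ) (i : ℕ) :
    ((ℕ → V) → ℂ) →ₗ[ℂ] ((ℕ → V) → ℂ) where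
  toFun F := fun w => (μ (w i))⁻¹ * ∑ b, F (ins i w b)
  map_add' F G := by
    ext w; simp [Finset.sum_add_distrib, mul_add]
  map_smul' c F := by
    ext w; simp [← Finset.mul_sum]; ring

section
variable {V : Type}

theorem ins_ee (i : ℕ) (w : ℕ → V) (b : V) (y : ℕ) : ins i w b (ee i y) = w y := by
  unfold ins ee
  split_ifs <;> first | rfl | omega
theorem ins_ee1 (i : ℕ) (w : ℕ → V) (b : V) (y : ℕ) : ins i w b (ee i y + 1) = w (y + 1) := by
  unfold ins ee
  split_ifs <;> first | rfl | omega
theorem ins_0 (i : ℕ) (w : ℕ → V) (b : V) : ins i w b 0 = w 0 := by simp [ins]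
theorem ins_i (i : ℕ) (w : ℕ → V) (b : V) : ins i w b i = w i := by simp [ins]
theorem ins_i1 (i : ℕ) (w : ℕ → V) (b : V) : ins i w b (i+1) = b := by simp [ins]
theorem ins_i2 (i : ℕ) (w : ℕ → V) (b : V) : ins i w b (i+1+1) = w i := by simp [ins]

theorem interval {adj : V → V → Prop} {base : V} {N : ℕ} {p : ℕ → ℕ} {w : ℕ → V} (hp : NCP N p)
    (hc : Cond adj base N p w) : ∀ d x y, y - x ≤ d → x ≤ y → y ≤ N →
      (∀ a, x ≤ a → a < y → x ≤ p a ∧ p a < y) → w x = w y := by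
  intro d
  induction d with
  | zero => intro x y h1 h2 _ _; rw [show x = y by omega]
  | succ d ih =>
    intro x y h1 h2 h3 h4
    by_cases hxy : x = y
    · rw [hxy]
    have h5 := h4 x le_rfl (by omega)
    have h6 := hp.ne x (by omega)
    rw [← (hc.2 x (by omega)).2]
    apply ih _ _ (by omega) (by omega) h3
    intro a ha1 ha2
    have h7 := h4 a (by omega) ha2
    have h8 := hp.ne a (by omega)
    have h9 := hp.inv a (by omega)
    have h10 := hp.inv x (by omega)
    have h11 : p a ≠ x := by intro h; rw [h] at h9; omega
    have h12 : p a ≠ p x := by intro h; rw [h] at h9; omega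
    have h13 := hp.nc x (p a) (by omega) (by omega)
    rw [h9] at h13
    omega

theorem forall_split {N i : ℕ} (hi : i ≤ N) (P : ℕ → Prop) :
    (∀ a, a < N + 2 → P a) ↔ P i ∧ P (i+1) ∧ ∀ y, y < N → P (ee i y) := by
  constructor
  · intro h
    exact ⟨h _ (by omega), h _ (by omega), fun y hy => h _ (ee_bd hy)⟩
  · rintro ⟨h1, h2, h3⟩ a ha
    by_cases e1 : a = i
    · rwa [e1]
    by_cases e2 : a = i + 1
    · rwa [e2]
    rw [← ee_dd e1 e2]
    exact h3 _ (dd_bd hi ha e1 e2)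

theorem condA {adj : V → V → Prop} (hadj : ∀ a b, adj a b → adj b a) {base : V} {N i : ℕ} {p : ℕ → ℕ}
    (hp : NCP (N + 2) p) (hi : i ≤ N) (h : p i = i + 1) (w : ℕ → V) (b : V) :
    Cond adj base (N + 2) p (ins i w b) ↔ Cond adj base N (del i p) w ∧ adj (w i) b := by
  have h' : p (i+1) = i := by rw [← h]; exact hp.inv i (by omega)
  unfold Cond
  rw [forall_split hi, ins_0, h, h', ins_i, ins_i1, ins_i2]
  have : ∀ y, y < N → ((adj (ins i w b (ee i y)) (ins i w b (ee i y + 1)) ∧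
      ins i w b (p (ee i y) + 1) = ins i w b (ee i y)) ↔
      (adj (w y) (w (y+1)) ∧ w (del i p y + 1) = w y)) := by
    intro y hy
    rw [← (del_specA hp hi h hy).2, ins_ee, ins_ee1, ins_ee1]
  have h2 : (∀ y, y < N → (adj (ins i w b (ee i y)) (ins i w b (ee i y + 1)) ∧
      ins i w b (p (ee i y) + 1) = ins i w b (ee i y))) ↔ (∀ y, y < N → 
      (adj (w y) (w (y+1)) ∧ w (del i p y + 1) = w y)) :=
    forall_congr' fun y => forall_congr' fun hy => this y hy
  rw [h2]
  have := hadj (w i) b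
  tauto

theorem capA [Fintype V] {adj : V → V → Prop} (hadj : ∀ a b, adj a b → adj b a) {base : V}
    {μ : V → ℂ} (hμ : ∀ a, μ a ≠ 0) {δ : ℂ} [DecidableRel adj]
    (hδ : ∀ a, ∑ b, (if adj a b then μ b else 0) = δ * μ a) {N i : ℕ} {p : ℕ → ℕ}
    (hp : NCP (N + 2) p) (hi : i ≤ N) (h : p i = i + 1) :
    cap μ i (phi adj base μ (N + 2) p) = δ • phi adj base μ N (del i p) := by
  have h' : p (i+1) = i := by rw [← h]; exact hp.inv i (by omega)
  ext w
  simp only [cap, LinearMap.coe_mk, AddHom.coe_mk, Pi.smul_apply, smul_eq_mul]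
  have key : ∀ b, phi adj base μ (N + 2) p (ins i w b) =
      (if adj (w i) b then μ b else 0) * phi adj base μ N (del i p) w := by
    intro b
    unfold phi
    rw [condA hadj hp hi h, prod_split _ hi]
    by_cases c1 : Cond adj base N (del i p) w
    · by_cases c2 : adj (w i) b
      · rw [if_pos ⟨c1, c2⟩, if_pos c1, if_pos c2, h, h', if_pos (by omega), if_neg (by omega), ins_i1,
          mul_one]
        congr 1
        apply Finset.prod_congr rfl
        intro y hy
        rw [← (del_specA hp hi h (Finset.mem_range.1 hy)).2, ins_ee1]
        simp only [ee_lt]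
      · simp [c2]
    · simp [c1]
  simp only [key]
  rw [← Finset.sum_mul, hδ]
  have := hμ (w i)
  field_simp

theorem capB [Fintype V] {adj : V → V → Prop} (hadj : ∀ a b, adj a b → adj b a) {base : V}
    {μ : V → ℂ} (hμ : ∀ a, μ a ≠ 0) {N i : ℕ} {p : ℕ → ℕ}
    (hp : NCP (N + 2) p) (hi : i ≤ N) (hpi : p i ≠ i + 1) :
    cap μ i (phi adj base μ (N + 2) p) = phi adj base μ N (del i p) := by
  classical
  have b2 := hp.inv i (by omega)
  have b3 := hp.inv (i+1) (by omega)
  have b4 := hp.ne i (by omega)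
  have b5 := hp.ne (i+1) (by omega)
  have b7 := hp.lt i (by omega)
  have b8 := hp.lt (i+1) (by omega)
  have b9 : p (i+1) ≠ i := by grind
  have b10 : p (i+1) ≠ p i := by grind
  have hj : ∃ j, j < N ∧ ee i j = p i := ⟨dd i (p i), dd_bd hi b7 b4 hpi, ee_dd b4 hpi⟩
  have hk : ∃ k, k < N ∧ ee i k = p (i+1) := ⟨dd i (p (i+1)), dd_bd hi b8 b9 b5, ee_dd b9 b5⟩
  obtain ⟨j, hjN, hj⟩ := hj
  obtain ⟨k, hkN, hk⟩ := hk
  have hkj : del i p k = j := by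
    have := (del_spec hp hi hkN).2
    rw [← ee_inj (i := i)]
    grind
  have hjk : del i p j = k := by
    have := (del_spec hp hi hjN).2
    rw [← ee_inj (i := i)]
    grind
  have hold : ∀ y, y < N → y ≠ j → y ≠ k → ee i (del i p y) = p (ee i y) := by
    intro y hy h1 h2
    have := (del_spec hp hi hy).2
    rw [ne_eq, ← ee_inj (i := i)] at h1 h2
    grind
  have hjne : j ≠ k := by rw [ne_eq, ← ee_inj (i := i)]; grind
  have hp' := del_ncp hp hi
  have pj : p (ee i j) = i := by rw [hj, b2]
  have pk : p (ee i k) = i + 1 := by rw [hk, b3]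
  have hlt : ∀ y, (y < i ∧ ee i y = y) ∨ (i ≤ y ∧ ee i y = y + 2) := by
    intro y; unfold ee; split_ifs <;> omega
  -- possible orders
  have ord : (j < i ∧ i ≤ k) ∨ (k < j ∧ j < i) ∨ (i ≤ k ∧ k < j) := by
    have q1 := hp.nc i (i+1) (by omega) (by omega)
    have q2 := hp.nc (p i) (i+1) b7 (by omega)
    have q3 := hp.nc (p (i+1)) i b8 (by omega)
    rw [b2] at q2
    rw [b3] at q3
    have := hlt j
    have := hlt k
    omega
  ext w
  simp only [cap, LinearMap.coe_mk, AddHom.coe_mk]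
  have geo : Cond adj base N (del i p) w → w (j+1) = w i := by
    intro hc
    by_cases hji : j < i
    · apply interval hp' hc _ _ _ le_rfl (by omega) hi
      intro a ha1 ha2
      have e1 := hold a (by omega) (by omega) (by omega)
      have q := hp.nc (p i) (ee i a) b7 (ee_bd (by omega))
      rw [b2, ← e1] at q
      have := hlt j
      have := hlt a
      have := hlt (del i p a)
      omega
    · have e0 := (hc.2 k hkN).2
      have e0' := (hc.2 j hjN).2
      rw [hkj] at e0
      rw [e0]
      symm
      apply interval hp' hc _ _ _ le_rfl (by omega) (by omega)
      intro a ha1 ha2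
      have e1 := hold a (by omega) (by omega) (by omega)
      have q := hp.nc (i+1) (ee i a) (by omega) (ee_bd (by omega))
      rw [← e1] at q
      have := hlt k
      have := hlt a
      have := hlt (del i p a)
      omega
  have cond : ∀ b, Cond adj base (N + 2) p (ins i w b) ↔ Cond adj base N (del i p) w ∧ b = w j := by
    intro b
    unfold Cond
    rw [forall_split hi, ins_0, ins_i, ins_i1, ins_i2, ← hj, ← hk, ins_ee1, ins_ee1]
    constructor
    · rintro ⟨h0, ⟨h1, h2⟩, ⟨h3, h4⟩, h5⟩
      have hbj := h5 j hjN
      have hbk := h5 k hkN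
      rw [pj, ins_i1, ins_ee] at hbj
      rw [pk, ins_i2, ins_ee] at hbk
      refine ⟨⟨h0, ?_⟩, hbj.2⟩
      intro y hy
      have h6 := h5 y hy
      rw [ins_ee, ins_ee1] at h6
      refine ⟨h6.1, ?_⟩
      by_cases y1 : y = j
      · subst y1; rw [hjk, h4, hbj.2]
      by_cases y2 : y = k
      · subst y2; rw [hkj, h2, hbk.2]
      have h7 := h6.2
      rwa [← hold y hy y1 y2, ins_ee1] at h7
    · rintro ⟨hc, rfl⟩
      have g := geo hc
      obtain ⟨h0, h5⟩ := hc
      have hbj := h5 j hjN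
      have hbk := h5 k hkN
      rw [hjk] at hbj
      rw [hkj] at hbk
      have hik : w i = w k := by rw [← g, hbk.2]
      have ad : adj (w i) (w j) := by rw [hik, ← hbj.2]; exact hbk.1
      refine ⟨h0, ⟨ad, g⟩, ⟨hadj _ _ ad, hbj.2⟩, ?_⟩
      intro y hy
      rw [ins_ee, ins_ee1]
      refine ⟨(h5 y hy).1, ?_⟩
      by_cases y1 : y = j
      · subst y1; rw [pj, ins_i1]
      by_cases y2 : y = k
      · subst y2; rw [pk, ins_i2, hik]
      rw [← hold y hy y1 y2, ins_ee1]
      exact (h5 y hy).2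
  have key : ∀ b, phi adj base μ (N + 2) p (ins i w b) =
      if b = w j then μ (w i) * phi adj base μ N (del i p) w else 0 := by
    intro b
    unfold phi
    rw [cond]
    by_cases c1 : Cond adj base N (del i p) w
    swap
    · simp [c1]
    by_cases c2 : b = w j
    swap
    · simp [c2]
    rw [if_pos ⟨c1, c2⟩, if_pos c1, if_pos c2, prod_split _ hi, ins_i1, ins_i2]
    have g := geo c1
    have hbj := (c1.2 j hjN).2
    rw [hjk] at hbj
    simp only [ins_ee1]
    have mj : j ∈ Finset.range N := Finset.mem_range.2 hjN
    have mk : k ∈ (Finset.range N).erase j := Finset.mem_erase.2 ⟨hjne.symm, Finset.mem_range.2 hkN⟩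
    rw [← Finset.mul_prod_erase _ _ mj, ← Finset.mul_prod_erase _ _ mk,
      ← Finset.mul_prod_erase _ _ mj, ← Finset.mul_prod_erase _ _ mk]
    have rest : ∏ x ∈ ((Finset.range N).erase j).erase k,
        (if ee i x < p (ee i x) then μ (w (x + 1)) else 1) =
        ∏ x ∈ ((Finset.range N).erase j).erase k, (if x < del i p x then μ (w (x + 1)) else 1) := by
      apply Finset.prod_congr rfl
      intro y hy
      simp only [Finset.mem_erase, Finset.mem_range] at hy
      rw [← hold y hy.2.2 hy.2.1 hy.1]
      simp only [ee_lt]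
    rw [rest, pj, pk, hjk, hkj, hbj, g, ← hj, ← hk, c2]
    have hlj := hlt j
    have hlk := hlt k
    rcases ord with o | o | o
    · rw [if_neg (by omega), if_pos (by omega), if_pos (by omega), if_neg (by omega), if_pos (by omega),
        if_neg (by omega)]
      ring
    · rw [if_neg (by omega), if_neg (by omega), if_pos (by omega), if_pos (by omega), if_neg (by omega),
        if_pos (by omega)]
      ring
    · rw [if_pos (by omega), if_pos (by omega), if_neg (by omega), if_neg (by omega), if_neg (by omega),
        if_pos (by omega)]
      ring
  simp only [key]
  rw [Finset.sum_ite_eq' Finset.univ (w j), if_pos (Finset.mem_univ _)]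
  have := hμ (w i)
  field_simp

theorem exists_ev [Fintype V] {adj : V → V → Prop} (hadj : ∀ a b, adj a b → adj b a) (base : V)
    {μ : V → ℂ} (hμ : ∀ a, μ a ≠ 0) {δ : ℂ} [DecidableRel adj]
    (hδ : ∀ a, ∑ b, (if adj a b then μ b else 0) = δ * μ a) (n : ℕ) :
    ∀ r, NCP (2 * n) r → ∃ ev : ((ℕ → V) → ℂ) →ₗ[ℂ] ℂ, ∀ p, NCP (2 * n) p →
      ev (phi adj base μ (2 * n) p) = δ ^ cnt (2 * n) p r := by
  induction n with
  | zero =>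
    intro r _
    refine ⟨LinearMap.proj (fun _ => base), ?_⟩
    intro p _
    have : cnt (2 * 0) p r = 0 := by
      unfold cnt
      rw [Nat.card_eq_zero]
      left
      constructor
      rintro ⟨x⟩
      exact absurd x.2 (by omega)
    rw [this]
    simp [phi, Cond]
  | succ n ih =>
    intro r hr
    rw [show 2 * (n + 1) = 2 * n + 2 by ring] at *
    obtain ⟨i, hi, hri⟩ := short_arc hr (by omega)
    have hi : i ≤ 2 * n := by omega
    obtain ⟨ev, hev⟩ := ih (del i r) (del_ncp hr hi)
    refine ⟨ev ∘ₗ cap μ i, ?_⟩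
    intro p hp
    rw [LinearMap.comp_apply]
    by_cases h : p i = i + 1
    · rw [capA hadj hμ hδ hp hi h, map_smul, hev _ (del_ncp hp hi), cntA hp hr hi hri h, pow_succ,
        smul_eq_mul, mul_comm]
    · rw [capB hadj hμ hp hi h, hev _ (del_ncp hp hi), cntB hp hr hi hri h]
end

def toN {n : ℕ} (π : Equiv.Perm (Fin (2 * n))) (x : ℕ) : ℕ :=
  if h : x < 2 * n then (π ⟨x, h⟩).1 else x

theorem toN_val {n : ℕ} (π : Equiv.Perm (Fin (2 * n))) (x : Fin (2 * n)) : toN π x = (π x).1 := by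
  simp [toN]

theorem toN_ncp {n : ℕ} (π : NCMatching n) : NCP (2 * n) (toN π.1) := by
  obtain ⟨π, h1, h2, h3⟩ := π
  simp only
  have hlt : ∀ x, x < 2 * n → toN π x < 2 * n := by
    intro x hx
    rw [toN, dif_pos hx]
    exact (π ⟨x, hx⟩).2
  refine ⟨hlt, ?_, ?_, ?_⟩
  · intro x hx
    rw [toN, dif_pos hx]
    intro h
    exact h1 ⟨x, hx⟩ (Fin.ext h)
  · intro x hx
    rw [show x = (⟨x, hx⟩ : Fin (2 * n)).1 from rfl, toN_val, toN_val, h2]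
  · intro a b ha hb hab hba
    obtain ⟨a, rfl⟩ : ∃ a' : Fin (2 * n), a'.1 = a := ⟨⟨a, ha⟩, rfl⟩
    obtain ⟨b, rfl⟩ : ∃ a' : Fin (2 * n), a'.1 = b := ⟨⟨b, hb⟩, rfl⟩
    rw [toN_val] at *
    rw [toN_val]
    have q1 : π b ≠ a := by intro h; have := h2 b; rw [h] at this; rw [this] at hba; omega
    have q2 : π b ≠ π a := by intro h; have := h2 b; rw [h, h2] at this; rw [this] at hab; omega
    constructor
    · by_contra hc
      refine h3 (π b) a b (π a) ?_ hab hba (h2 b) rfl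
      rw [ne_eq, Fin.ext_iff] at q1
      show (π b).1 < a.1
      omega
    · by_contra hc
      refine h3 a b (π a) (π b) hab hba ?_ rfl rfl
      rw [ne_eq, Fin.ext_iff] at q2
      show (π a).1 < (π b).1
      omega

theorem loopCount_eq {n : ℕ} (π ρ : Equiv.Perm (Fin (2 * n))) :
    loopCount n π ρ = cnt (2 * n) (toN π) (toN ρ) := by
  unfold loopCount cnt
  apply card_quot (r := (SimpleGraph.fromRel fun v w => π v = w ∨ ρ v = w).Reachable) id id
  · rintro x x' ⟨wk⟩
    induction wk with
    | nil => rfl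
    | cons h _ ih =>
      rw [← ih]
      rw [SimpleGraph.fromRel_adj] at h
      rcases h.2 with (h | h) | (h | h)
      · exact Quot.sound (Or.inl (by rw [toN_val, ← h]; rfl))
      · exact Quot.sound (Or.inr (by rw [toN_val, ← h]; rfl))
      · symm; exact Quot.sound (Or.inl (by rw [toN_val, ← h]; rfl))
      · symm; exact Quot.sound (Or.inr (by rw [toN_val, ← h]; rfl))
  · intro x x' h
    simp only [toN_val, ← Fin.ext_iff] at h
    by_cases hx : x = x'
    · rw [hx]
    apply Quot.sound
    apply SimpleGraph.Adj.reachable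
    rw [SimpleGraph.fromRel_adj]
    exact ⟨hx, Or.inl h⟩
  · intro x; rfl
  · intro x; rfl

theorem exists_matching {n : ℕ} (h : ℕ → ℕ) (h0 : h 0 = 0) (h2n : h (2 * n) = 0)
    (hs : ∀ a, a < 2 * n → h a + 1 = h (a+1) ∨ h (a+1) + 1 = h a) :
    ∃ π : NCMatching n, ∀ a : Fin (2 * n), a < π.1 a ↔ h a < h (a + 1) := by
  let Arc : ℕ → ℕ → Prop := fun a b => a < b ∧ b < 2 * n ∧ h a = h (b+1) ∧ ∀ x, a < x → x ≤ b → h a < h x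
  have u1 : ∀ x y y', Arc x y → Arc x y' → y = y' := by
    rintro x y y' ⟨a1, a2, a3, a4⟩ ⟨b1, b2, b3, b4⟩
    by_contra hne
    rcases Nat.lt_or_gt_of_ne hne with hl | hl
    · have := b4 (y+1) (by omega) (by omega); omega
    · have := a4 (y'+1) (by omega) (by omega); omega
  have u2 : ∀ x y y', Arc y x → Arc y' x → y = y' := by
    rintro x y y' ⟨a1, a2, a3, a4⟩ ⟨b1, b2, b3, b4⟩
    by_contra hne
    rcases Nat.lt_or_gt_of_ne hne with hl | hl
    · have := a4 y' (by omega) (by omega); omega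
    · have := b4 y (by omega) (by omega); omega
  have up : ∀ x y, Arc x y → h x < h (x+1) := by
    rintro x y ⟨a1, a2, a3, a4⟩
    exact a4 _ (by omega) (by omega)
  have down : ∀ x y, Arc y x → h (x+1) < h x := by
    rintro x y ⟨a1, a2, a3, a4⟩
    have := a4 x (by omega) (by omega)
    omega
  have ex : ∀ x : Fin (2 * n), ∃ y : Fin (2 * n), Arc x y ∨ Arc y x := by
    intro x
    rcases hs x x.2 with hx | hx
    · have hex : ∃ z, x.1 < z ∧ h z ≤ h x := ⟨2 * n, x.2, by omega⟩
      have hf := Nat.find_spec hex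
      have hm : ∀ m, m < Nat.find hex → ¬ (x.1 < m ∧ h m ≤ h x) := fun m hm => Nat.find_min hex hm
      have hle : Nat.find hex ≤ 2 * n := Nat.find_min' hex ⟨x.2, by omega⟩
      generalize Nat.find hex = z at *
      have hz : z ≠ x + 1 := by rintro rfl; omega
      have h1 := hm (z-1) (by omega)
      have h2 := hs (z-1) (by omega)
      rw [show z - 1 + 1 = z by omega] at h2
      refine ⟨⟨z-1, by omega⟩, Or.inl ⟨by simp only; omega, by simp only; omega, ?_, ?_⟩⟩
      · simp only
        rw [show z - 1 + 1 = z by omega]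
        omega
      · intro y hy1 hy2
        simp only at hy2
        have := hm y (by omega)
        omega
    · have hf : h (Nat.findGreatest (fun y => h y ≤ h (x+1)) x) ≤ h (x+1) :=
        Nat.findGreatest_spec (P := fun y => h y ≤ h (x+1)) (Nat.zero_le x.1) (by omega)
      have hle := Nat.findGreatest_le (P := fun y => h y ≤ h (x+1)) x.1
      have hg : ∀ k, Nat.findGreatest (fun y => h y ≤ h (x+1)) x < k → k ≤ x.1 → ¬ h k ≤ h (x+1) :=
        fun k h1 h2 =>
          Nat.findGreatest_is_greatest (P := fun y => h y ≤ h (x+1)) h1 h2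
      generalize Nat.findGreatest (fun y => h y ≤ h (x+1)) x.1 = y at *
      have hy : y ≠ x := by rintro rfl; omega
      have h1 := hg (y+1) (by omega) (by omega)
      have h2 := hs y (by omega)
      refine ⟨⟨y, by omega⟩, Or.inr ⟨by simp only; omega, x.2, by simp only; omega, ?_⟩⟩
      intro z hz1 hz2
      simp only at hz1 ⊢
      have := hg z hz1 hz2
      omega
  choose p hp using ex
  have inv : ∀ x, p (p x) = x := by
    intro x
    have c1 := hp x
    have c2 := hp (p x)
    apply Fin.ext
    rcases c1 with c1 | c1 <;> rcases c2 with c2 | c2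
    · have := up _ _ c2; have := down _ _ c1; omega
    · exact u2 _ _ _ c2 c1
    · exact u1 _ _ _ c2 c1
    · have := up _ _ c1; have := down _ _ c2; omega
  have hlt : ∀ a, a < p a ↔ h a < h (a + 1) := by
    intro a
    rcases hp a with c | c
    · exact iff_of_true c.1 (up _ _ c)
    · have h1 := c.1
      have h2 := down _ _ c
      exact iff_of_false (by rw [Fin.lt_def]; omega) (by omega)
  have arc : ∀ a, a < p a → Arc a (p a) := by
    intro a ha
    rcases hp a with c | c
    · exact c
    · have h1 := c.1
      rw [Fin.lt_def] at ha
      omega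
  refine ⟨⟨Function.Involutive.toPerm p inv, ?_, ?_, ?_⟩, ?_⟩
  · intro v hv
    have hv : p v = v := hv
    rcases hp v with c | c <;> have h1 := c.1 <;> rw [hv] at h1 <;> omega
  · exact inv
  · intro a b c d hab hbc hcd hac hbd
    have hac : p a = c := hac
    have hbd : p b = d := hbd
    have c1 := arc a (by rw [hac]; exact hab.trans hbc)
    have c2 := arc b (by rw [hbd]; exact hbc.trans hcd)
    rw [hac] at c1
    rw [hbd] at c2
    rw [Fin.lt_def] at *
    have := c1.2.2.2 b hab (by omega)
    have := c2.2.2.2 (c+1) (by omega) (by omega)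
    have := c1.2.2.1
    omega
  · exact hlt

def fadj (n : ℕ) (a b : Fin n) : Prop := a.1 + 1 = b.1 ∨ b.1 + 1 = a.1

instance (n : ℕ) : DecidableRel (fadj n) := fun a b => by unfold fadj; infer_instance

abbrev Wk (n : ℕ) (base : Fin n) : Type :=
  {w : ℕ → Fin n // w 0 = base ∧ (∀ a, a < 2 * n → fadj n (w a) (w (a+1))) ∧ ∀ x, 2 * n ≤ x → w x = base}

theorem wk_inj {n : ℕ} (base : Fin n) (hb : base.1 = 0) :
    ∃ f : Wk n base → NCMatching n, Function.Injective f ∧ ¬ Function.Surjective f := by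
  have : ∀ w : Wk n base, ∃ π : NCMatching n, ∀ a : Fin (2 * n), a < π.1 a ↔
      (w.1 a).1 < (w.1 (a + 1)).1 := by
    rintro ⟨w, h1, h2, h3⟩
    exact exists_matching (fun x => (w x).1) (by simp only [h1, hb])
      (by rw [h3 _ le_rfl, hb]) h2
  choose f hf using this
  refine ⟨f, ?_, ?_⟩
  · intro w w' hw
    have e : ∀ a : Fin (2 * n), (w.1 a).1 < (w.1 (a + 1)).1 ↔ (w'.1 a).1 < (w'.1 (a + 1)).1 := by
      intro a; rw [← hf, ← hf, hw]
    have key : ∀ x, x ≤ 2 * n → w.1 x = w'.1 x := by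
      intro x
      induction x with
      | zero => intro _; rw [w.2.1, w'.2.1]
      | succ x ih =>
        intro hx
        have i1 := congrArg Fin.val (ih (by omega))
        have i2 := w.2.2.1 x (by omega)
        have i3 := w'.2.2.1 x (by omega)
        have i4 := e ⟨x, by omega⟩
        simp only at i4
        unfold fadj at i2 i3
        ext
        omega
    apply Subtype.ext
    funext x
    by_cases hx : x ≤ 2 * n
    · exact key x hx
    · rw [w.2.2.2 x (by omega), w'.2.2.2 x (by omega)]
  · intro hsurj
    obtain ⟨w, hw⟩ := hsurj ⟨Fin.revPerm, by
      refine ⟨?_, ?_, ?_⟩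
      · intro v hv
        have := congrArg Fin.val hv
        simp [Fin.val_rev] at this
        omega
      · intro v; simp
      · intro a b c d h1 h2 h3 h4 h5
        simp only [Fin.revPerm_apply] at h4 h5
        have := congrArg Fin.val h4
        have := congrArg Fin.val h5
        rw [Fin.val_rev] at *
        rw [Fin.lt_def] at *
        omega⟩
    have key : ∀ x, x ≤ n → (w.1 x).1 = x := by
      intro x
      induction x with
      | zero => intro _; rw [w.2.1, hb]
      | succ x ih =>
        intro hx
        have i1 := ih (by omega)
        have i2 := w.2.2.1 x (by omega)
        have i3 := hf w ⟨x, by omega⟩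
        rw [hw] at i3
        simp only [Fin.revPerm_apply, Fin.lt_def, Fin.val_rev] at i3
        unfold fadj at i2
        omega
    have := key n le_rfl
    have := (w.1 n).2
    omega

theorem mu_sum {n : ℕ} (r s : ℂ) (hrs : r * s = 1) (hz : r ^ (n+1) - s ^ (n+1) = 0) (a : Fin n) :
    ∑ b : Fin n, (if fadj n a b then r ^ (b.1+1) - s ^ (b.1+1) else 0) =
      (r + s) * (r ^ (a.1+1) - s ^ (a.1+1)) := by
  obtain ⟨a, ha⟩ := a
  have e : ∀ b : Fin n, (if fadj n ⟨a, ha⟩ b then r ^ (b.1+1) - s ^ (b.1+1) else 0) =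
      (if a + 1 = b.1 then r ^ (a+2) - s ^ (a+2) else 0) +
      (if b.1 + 1 = a then r ^ a - s ^ a else 0) := by
    intro b
    have hf : fadj n ⟨a, ha⟩ b ↔ (a + 1 = b.1 ∨ b.1 + 1 = a) := Iff.rfl
    simp only [hf]
    by_cases c1 : a + 1 = b.1
    · rw [if_pos (Or.inl c1), if_pos c1, if_neg (by omega), ← c1]; ring
    · by_cases c2 : b.1 + 1 = a
      · rw [if_pos (Or.inr c2), if_neg c1, if_pos c2, c2]; ring
      · rw [if_neg (by tauto), if_neg c1, if_neg c2]; ring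
  rw [Finset.sum_congr rfl (fun b _ => e b), Finset.sum_add_distrib]
  have s1 : ∑ b : Fin n, (if a + 1 = b.1 then r ^ (a+2) - s ^ (a+2) else 0) = r ^ (a+2) - s ^ (a+2) := by
    by_cases h : a + 1 < n
    · rw [Finset.sum_eq_single ⟨a+1, h⟩]
      · simp
      · intro b _ hb
        rw [if_neg]
        intro h'; exact hb (Fin.ext h'.symm)
      · simp
    · have : a + 1 = n := by omega
      rw [show a + 2 = n + 1 by omega, hz]
      simp
  have s2 : ∑ b : Fin n, (if b.1 + 1 = a then r ^ a - s ^ a else 0) = r ^ a - s ^ a := by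
    by_cases h : 0 < a
    · rw [Finset.sum_eq_single ⟨a-1, by omega⟩]
      · simp only; rw [if_pos (by omega)]
      · intro b _ hb
        rw [if_neg]
        intro h'; exact hb (Fin.ext (by simp only; omega))
      · simp
    · have : a = 0 := by omega
      subst this
      simp
  rw [s1, s2]
  have : s * r ^ (a+1) = r ^ a := by rw [pow_succ, mul_comm, mul_assoc, hrs, mul_one]
  have h2 : r * s ^ (a+1) = s ^ a := by rw [pow_succ, mul_comm, mul_assoc, mul_comm s r, hrs, mul_one]
  linear_combination - this + h2

/-- If `A` is a primitive `4(n+1)`-th root of unity, then the Gram matrix of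
Lickorish's bilinear form on `TL_n`, with entries `δ^{c(π,ρ)}` for
`δ = -A² - A^{-2}`, is singular. -/
theorem gram_det_singular (n : ℕ) (hn : 1 ≤ n) (A : ℂ)
    (hA : IsPrimitiveRoot A (4 * (n + 1))) :
    (Matrix.of fun π ρ : NCMatching n =>
        (-A ^ 2 - A ^ (-2 : ℤ)) ^ loopCount n π.1 ρ.1).det = 0 := by
  classical
  have hA0 : A ≠ 0 := hA.ne_zero (by omega)
  obtain ⟨r, hr⟩ : ∃ r : ℂ, r = -A ^ 2 := ⟨_, rfl⟩
  obtain ⟨s, hs⟩ : ∃ s : ℂ, s = -A ^ (-2 : ℤ) := ⟨_, rfl⟩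
  have hrs : r * s = 1 := by
    rw [hr, hs, zpow_neg]
    have : A ^ (2 : ℤ) = A ^ 2 := by norm_cast
    rw [this]
    field_simp
  have hr0 : r ≠ 0 := left_ne_zero_of_mul_eq_one hrs
  have hfac : ∀ k : ℕ, r ^ k * (r ^ k - s ^ k) = A ^ (4 * k) - 1 := by
    intro k
    rw [mul_sub, ← mul_pow, ← mul_pow, hrs, hr, pow_mul]
    ring
  have hz : r ^ (n+1) - s ^ (n+1) = 0 := by
    have := hfac (n+1)
    rw [hA.pow_eq_one, sub_self] at this
    exact (mul_eq_zero.1 this).resolve_left (pow_ne_zero _ hr0)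
  let μ : Fin n → ℂ := fun k => r ^ (k.1+1) - s ^ (k.1+1)
  have hμ : ∀ k, μ k ≠ 0 := by
    intro k hk
    have h1 := hfac (k.1+1)
    have hk : r ^ (k.1+1) - s ^ (k.1+1) = 0 := hk
    rw [hk, mul_zero] at h1
    have h2 : A ^ (4 * (k.1+1)) = 1 := (sub_eq_zero.1 h1.symm)
    have := hA.pow_ne_one_of_pos_of_lt (l := 4 * (k.1+1)) (by omega) (by have := k.2; omega)
    exact this h2
  have hδ : -A ^ 2 - A ^ (-2 : ℤ) = r + s := by rw [hr, hs]; ring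
  let base : Fin n := ⟨0, by omega⟩
  have hadj : ∀ a b, fadj n a b → fadj n b a := fun a b h => h.symm
  have hev := exists_ev (adj := fadj n) hadj base hμ (δ := r + s) (fun a => mu_sum r s hrs hz a) n
  obtain ⟨f, finj, fsurj⟩ := wk_inj base rfl
  haveI : Finite (Wk n base) := Finite.of_injective f finj
  haveI : Fintype (Wk n base) := Fintype.ofFinite _
  have hcard : Fintype.card (Wk n base) < Fintype.card (NCMatching n) :=
    Fintype.card_lt_of_injective_not_surjective f finj fsurj
  let Φ : NCMatching n → (ℕ → Fin n) → ℂ := fun π => phi (fadj n) base μ (2 * n) (toN π.1)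
  let L : (NCMatching n → ℂ) →ₗ[ℂ] (Wk n base → ℂ) :=
    Matrix.mulVecLin (Matrix.of fun w π => Φ π w.1)
  have hker : LinearMap.ker L ≠ ⊥ := by
    apply LinearMap.ker_ne_bot_of_finrank_lt
    simpa using hcard
  obtain ⟨v, hvL, hv0⟩ := (Submodule.ne_bot_iff _).1 hker
  have hΦ : ∑ π, v π • Φ π = 0 := by
    funext w
    by_cases hw : w 0 = base ∧ (∀ a, a < 2 * n → fadj n (w a) (w (a+1))) ∧ w (2 * n) = base
    · let w' : Wk n base := ⟨fun x => if x < 2 * n then w x else base, by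
        refine ⟨by simp [hw.1], ?_, ?_⟩
        · intro a ha
          simp only [ha, if_true]
          split_ifs with h
          · exact hw.2.1 a ha
          · have := hw.2.1 a ha
            rwa [show a + 1 = 2 * n by omega, hw.2.2] at this
        · intro x hx; simp only; rw [if_neg (by omega)]⟩
      have hww : ∀ x, x ≤ 2 * n → w'.1 x = w x := by
        intro x hx
        simp only [w']
        split_ifs with h
        · rfl
        · rw [show x = 2 * n by omega, hw.2.2]
      have hphi : ∀ π, Φ π w = Φ π w'.1 := by
        intro π
        have hp := toN_ncp π
        have hC : Cond (fadj n) base (2 * n) (toN π.1) w ↔ Cond (fadj n) base (2 * n) (toN π.1) w'.1 := by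
          unfold Cond
          rw [hww 0 (by omega)]
          refine and_congr Iff.rfl (forall_congr' fun a => forall_congr' fun ha => ?_)
          rw [hww a (by omega), hww (a+1) (by omega), hww (toN π.1 a + 1) (hp.lt a ha)]
        simp only [Φ, phi, hC]
        congr 1
        apply Finset.prod_congr rfl
        intro a ha
        rw [hww (a+1) (Finset.mem_range.1 ha)]
      have h1 := congrFun (LinearMap.mem_ker.1 hvL) w'
      simp only [L, Matrix.mulVecLin_apply, Matrix.mulVec, dotProduct, Matrix.of_apply] at h1
      rw [Finset.sum_apply]
      rw [Pi.zero_apply] at h1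
      rw [Pi.zero_apply, ← h1]
      apply Finset.sum_congr rfl
      intro π _
      rw [Pi.smul_apply, smul_eq_mul, hphi, mul_comm]
    · have hphi : ∀ π, Φ π w = 0 := by
        intro π
        simp only [Φ, phi]
        rw [if_neg]
        intro hc
        apply hw
        refine ⟨hc.1, fun a ha => (hc.2 a ha).1, ?_⟩
        have hp := toN_ncp π
        rw [← hc.1]
        exact (interval hp hc _ 0 (2 * n) le_rfl (by omega) le_rfl
          (fun a _ ha => ⟨by omega, hp.lt a ha⟩)).symm
      rw [Finset.sum_apply]
      simp [hphi]
  rw [← Matrix.exists_vecMul_eq_zero_iff]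
  refine ⟨v, hv0, ?_⟩
  funext ρ
  obtain ⟨ev, hev⟩ := hev _ (toN_ncp ρ)
  have h2 := congrArg ev hΦ
  rw [map_sum, map_zero] at h2
  rw [Pi.zero_apply, ← h2]
  simp only [Matrix.vecMul, dotProduct, Matrix.of_apply]
  apply Finset.sum_congr rfl
  intro π _
  rw [map_smul, smul_eq_mul, hev _ (toN_ncp π), loopCount_eq, hδ]
end

section
/- Fix an integer n ≥ 1 and let A ∈ ℂ be a nonzero complex number that is not a root of unity. Set δ = −A² − A^{−2}. Then the Gram matrix (δ^{c(π,ρ)})_{π,ρ ∈ NC(n)} of Lickorish's bilinear form on the Temperley–Lieb algebra TL_n is nonsingular, i.e. its determinant is nonzero. -/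
namespace TLGram

variable {N : ℕ}

/-- involutive, noncrossing -/
def INC (π : Equiv.Perm (Fin N)) : Prop :=
  (∀ v, π (π v) = v) ∧ ∀ a b : Fin N, a < b → b < π a → π a < π b → False

/-- no fixed point under an arc -/
def NFU (π : Equiv.Perm (Fin N)) : Prop :=
  ∀ a b : Fin N, a < b → b < π a → π b ≠ b

/-- arc factor -/
def psi (M : Bool → Bool → ℂ) (π : Equiv.Perm (Fin N)) (s : Fin N → Bool) (l : Fin N) : ℂ :=
  if l < π l then M (s l) (s (π l)) else 1

/-- vector -/
def vec (M : Bool → Bool → ℂ) (π : Equiv.Perm (Fin N)) (s : Fin N → Bool) : ℂ :=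
  ∏ l, psi M π s l

/-- pairing -/
def Z (M : Bool → Bool → ℂ) (π ρ : Equiv.Perm (Fin N)) : ℂ :=
  ∑ s : Fin N → Bool, vec M π s * vec M ρ s

/-- loop value -/
def dl (M : Bool → Bool → ℂ) : ℂ := ∑ x, ∑ y, M x y * M x y

/-- identity matrix -/
def idM : Bool → Bool → ℂ := fun x y => if x = y then 1 else 0

lemma Z_idM (π ρ : Equiv.Perm (Fin N)) (hπ : ∀ v, π (π v) = v) (hρ : ∀ v, ρ (ρ v) = v) :
    Z idM π ρ = (2 : ℂ) ^ Nat.card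
      (SimpleGraph.fromRel fun v w => π v = w ∨ ρ v = w).ConnectedComponent := by
  classical
  set G := (SimpleGraph.fromRel fun v w => π v = w ∨ ρ v = w) with hG
  have key : ∀ (π : Equiv.Perm (Fin N)), (∀ v, π (π v) = v) → ∀ s : Fin N → Bool,
      vec idM π s = if (∀ i, s (π i) = s i) then 1 else 0 := by
    intro π hπ s
    split_ifs with h
    · apply Finset.prod_eq_one
      intro i _
      simp [psi, idM, h]
    · push Not at h
      obtain ⟨i, hi⟩ := h
      rcases lt_trichotomy i (π i) with h1 | h1 | h1
      · apply Finset.prod_eq_zero (Finset.mem_univ i)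
        simp [psi, idM, h1, Ne.symm hi]
      · exact absurd (by rw [← h1]) hi
      · apply Finset.prod_eq_zero (Finset.mem_univ (π i))
        simp [psi, idM, h1, hi, hπ]
  let e : {s : Fin N → Bool // (∀ i, s (π i) = s i) ∧ (∀ i, s (ρ i) = s i)} ≃
      (G.ConnectedComponent → Bool) :=
    { toFun := fun s c => Quot.liftOn c s.1 (by
        intro a b hab
        obtain ⟨p⟩ := hab
        induction p with
        | nil => rfl
        | cons h _ ih =>
          rw [← ih]
          have := h
          rw [hG, SimpleGraph.fromRel_adj] at this
          rcases this with ⟨_, (h | h) | (h | h)⟩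
          · rw [← h, s.2.1]
          · rw [← h, s.2.2]
          · rw [← h, s.2.1]
          · rw [← h, s.2.2])
      invFun := fun f => ⟨fun i => f (G.connectedComponentMk i), by
        constructor
        · intro i
          by_cases h : π i = i
          · rw [h]
          · refine congrArg f ?_
            apply SimpleGraph.ConnectedComponent.sound
            apply SimpleGraph.Adj.reachable
            rw [hG, SimpleGraph.fromRel_adj]
            exact ⟨h, Or.inr (Or.inl rfl)⟩
        · intro i
          by_cases h : ρ i = i
          · rw [h]
          · refine congrArg f ?_
            apply SimpleGraph.ConnectedComponent.sound
            apply SimpleGraph.Adj.reachable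
            rw [hG, SimpleGraph.fromRel_adj]
            exact ⟨h, Or.inr (Or.inr rfl)⟩⟩
      left_inv := by
        intro s
        rfl
      right_inv := by
        intro f
        funext c
        induction c using SimpleGraph.ConnectedComponent.ind
        rfl }
  have h1 : Z idM π ρ = (Fintype.card
      {s : Fin N → Bool // (∀ i, s (π i) = s i) ∧ (∀ i, s (ρ i) = s i)} : ℂ) := by
    unfold Z
    rw [Fintype.card_subtype]
    rw [Finset.card_filter]
    push_cast
    apply Finset.sum_congr rfl
    intro s _
    rw [key π hπ, key ρ hρ]
    by_cases h1 : ∀ i, s (π i) = s i <;> by_cases h2 : ∀ i, s (ρ i) = s i <;> simp [h1, h2]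
  rw [h1, ← Nat.card_eq_fintype_card, Nat.card_congr e, Nat.card_fun]
  simp

lemma sum_update (f : (Fin N → Bool) → ℂ) (i : Fin N) :
    ∑ s, ∑ x, f (Function.update s i x) = 2 * ∑ s, f s := by
  classical
  have h1 : ∀ s : Fin N → Bool, ∑ x, f (Function.update s i x)
      = f s + f (Function.update s i (!s i)) := by
    intro s
    rw [Fintype.sum_bool]
    cases h : s i
    · have : Function.update s i false = s := by rw [← h]; simp
      rw [this]; simp [add_comm]
    · have : Function.update s i true = s := by rw [← h]; simp
      rw [this]; simp
  simp_rw [h1]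
  rw [Finset.sum_add_distrib]
  have : ∑ s : Fin N → Bool, f (Function.update s i (!s i)) = ∑ s, f s := by
    apply Finset.sum_nbij' (fun s => Function.update s i (!s i))
      (fun s => Function.update s i (!s i)) <;> simp
  rw [this]; ring

lemma Z_self (M : Bool → Bool → ℂ) (π : Equiv.Perm (Fin N)) (hπ : INC π) (hf : ∀ v, π v ≠ v) :
    Z M π π = dl M ^ Fintype.card {i : Fin N // i < π i} := by
  classical
  have hlt : ∀ i, ¬ i < π i → π i < π (π i) := by
    intro i h
    rw [hπ.1]
    exact lt_of_le_of_ne (not_lt.mp h) (hf i)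
  let e : (Fin N → Bool) ≃ ({i : Fin N // i < π i} → Bool × Bool) :=
    { toFun := fun s i => (s i.1, s (π i.1))
      invFun := fun f i => if h : i < π i then (f ⟨i, h⟩).1 else (f ⟨π i, hlt i h⟩).2
      left_inv := by
        intro s
        funext i
        by_cases h : i < π i <;> simp [h, hπ.1]
      right_inv := by
        intro f
        funext i
        have h := i.2
        have h' : ¬ π i.1 < π (π i.1) := by rw [hπ.1]; exact not_lt.mpr h.le
        ext
        · simp [h]
        · simp only [h', dite_false]
          congr 2
          ext
          simp [hπ.1] }
  have h2 : ∀ s, vec M π s * vec M π s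
      = ∏ i : {i : Fin N // i < π i}, (M (e s i).1 (e s i).2 * M (e s i).1 (e s i).2) := by
    intro s
    unfold vec
    rw [← Finset.prod_mul_distrib]
    have h3 := Finset.prod_subtype (F := inferInstance) (p := fun i => i < π i)
      (Finset.univ.filter fun i => i < π i) (by simp)
      (fun i => M (s i) (s (π i)) * M (s i) (s (π i)))
    refine Eq.trans ?_ h3
    rw [Finset.prod_filter]
    apply Finset.prod_congr rfl
    intro i _
    unfold psi
    split_ifs <;> simp
  unfold Z
  rw [Finset.sum_congr rfl (fun s _ => h2 s)]
  rw [Equiv.sum_comp e (fun f => ∏ i : {i : Fin N // i < π i}, (M (f i).1 (f i).2 * M (f i).1 (f i).2))]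
  rw [← Fintype.piFinset_univ]
  rw [Finset.sum_prod_piFinset (Finset.univ) (fun _ (p : Bool × Bool) => M p.1 p.2 * M p.1 p.2)]
  rw [Finset.prod_const, dl, Fintype.sum_prod_type, Finset.card_univ]

/-- weight of an arc joining two points -/
def arc (M : Bool → Bool → ℂ) (s : Fin N → Bool) (x y : Fin N) : ℂ :=
  if x < y then M (s x) (s y) else M (s y) (s x)

lemma psi_pair (M : Bool → Bool → ℂ) (π : Equiv.Perm (Fin N)) (s : Fin N → Bool) (x y : Fin N)
    (hxy : x ≠ y) (h1 : π x = y) (h2 : π y = x) :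
    psi M π s x * psi M π s y = arc M s x y := by
  unfold psi arc
  rw [h1, h2]
  rcases lt_or_gt_of_ne hxy with h | h
  · simp [h, not_lt.mpr h.le]
  · simp [h, not_lt.mpr h.le]

lemma vec_split2 (M : Bool → Bool → ℂ) (π : Equiv.Perm (Fin N)) (s : Fin N → Bool) (x y : Fin N)
    (hxy : x ≠ y) (h1 : π x = y) (h2 : π y = x) :
    vec M π s = arc M s x y * ∏ l ∈ {x, y}ᶜ, psi M π s l := by
  classical
  unfold vec
  rw [← Finset.prod_mul_prod_compl {x, y}, Finset.prod_pair hxy, psi_pair M π s x y hxy h1 h2]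

lemma vec_split4 (M : Bool → Bool → ℂ) (π : Equiv.Perm (Fin N)) (s : Fin N → Bool)
    (x y z w : Fin N)
    (hxy : x ≠ y) (h1 : π x = y) (h2 : π y = x) (hzw : z ≠ w) (h3 : π z = w) (h4 : π w = z)
    (hxz : x ≠ z) (hxw : x ≠ w) (hyz : y ≠ z) (hyw : y ≠ w) :
    vec M π s = arc M s x y * arc M s z w * ∏ l ∈ {x, y, z, w}ᶜ, psi M π s l := by
  classical
  unfold vec
  rw [← Finset.prod_mul_prod_compl {x, y, z, w}, ← psi_pair M π s x y hxy h1 h2,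
    ← psi_pair M π s z w hzw h3 h4]
  rw [Finset.prod_insert (by simp [*]), Finset.prod_insert (by simp [*]), Finset.prod_pair hzw]
  ring

/-- surgery -/
def surg (ρ : Equiv.Perm (Fin N)) (i j : Fin N) : Equiv.Perm (Fin N) :=
  ρ * Equiv.swap i (ρ j) * Equiv.swap j (ρ i)

lemma surg_apply (ρ : Equiv.Perm (Fin N)) (hρ : ∀ v, ρ (ρ v) = v) (hf : ∀ v, ρ v ≠ v)
    (i j : Fin N) (hij : i ≠ j) (hne : ρ i ≠ j) (l : Fin N) :
    surg ρ i j l = if l = i then j else if l = j then i else if l = ρ i then ρ j else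
      if l = ρ j then ρ i else ρ l := by
  have h1 := hρ i
  have h2 := hρ j
  have h3 := hf i
  have h4 := hf j
  have h5 : ρ j ≠ i := fun h => hne (by rw [← h, hρ])
  have h6 : ρ i ≠ ρ j := fun h => hij (ρ.injective h)
  simp only [surg, Equiv.Perm.mul_apply, Equiv.swap_apply_def]
  grind

lemma order_cases (ρ : Equiv.Perm (Fin N)) (hρ : INC ρ) (hf : ∀ v, ρ v ≠ v)
    (i j : Fin N) (hij : i < j) (hne : ρ i ≠ j) 
    (hin : ∀ l, i < l → l < j → i < ρ l ∧ ρ l < j) :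
    (ρ i < i ∧ j < ρ j) ∨ (ρ j < ρ i ∧ ρ i < i) ∨ (j < ρ j ∧ ρ j < ρ i) := by
  have h1 := hρ.1 i
  have h2 := hρ.1 j
  have h3 := hf i
  have h4 := hf j
  have h5 : ρ j ≠ i := fun h => hne (by rw [← h, hρ.1])
  have h6 : ρ i ≠ ρ j := fun h => hij.ne (ρ.injective h)
  have a1 := hin (ρ i)
  have a2 := hin (ρ j)
  have b1 := hρ.2 i j
  have b4 := hρ.2 (ρ i) (ρ j)
  have c2 := hρ.2 (ρ j) i
  rw [h1] at a1 b4
  rw [h2] at a2 b4 c2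
  have a1' : ρ i < i ∨ j < ρ i := by omega
  have a2' : ρ j < i ∨ j < ρ j := by omega
  clear a1 a2
  rcases a1' with h | h <;> rcases a2' with h' | h'
  · right; left
    refine ⟨?_, h⟩
    by_contra hc
    exact b4 (by omega) h' hij
  · left; exact ⟨h, h'⟩
  · exact (c2 h' hij h).elim
  · right; right
    refine ⟨h', ?_⟩
    by_contra hc
    exact b1 hij h (by omega)

lemma surg_INC (ρ : Equiv.Perm (Fin N)) (hρ : INC ρ) (hf : ∀ v, ρ v ≠ v)
    (i j : Fin N) (hij : i < j) (hne : ρ i ≠ j) 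
    (hin : ∀ l, i < l → l < j → i < ρ l ∧ ρ l < j) :
    INC (surg ρ i j) ∧ ∀ v, surg ρ i j v ≠ v := by
  have ap := surg_apply ρ hρ.1 hf i j hij.ne hne
  have oc := order_cases ρ hρ hf i j hij hne hin
  have h1 := hρ.1 i
  have h2 := hρ.1 j
  have h3 := hf i
  have h4 := hf j
  have h5 : ρ j ≠ i := fun h => hne (by rw [← h, hρ.1])
  have h6 : ρ i ≠ ρ j := fun h => hij.ne (ρ.injective h)
  have hinj : ∀ v w, ρ v = w → v = ρ w := fun v w h => by rw [← h, hρ.1]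
  have hinv : ∀ v, ρ (ρ v) = v := hρ.1
  have nc : ∀ l m, ¬ (l < m ∧ m < ρ l ∧ ρ l < ρ m) := fun l m h => hρ.2 l m h.1 h.2.1 h.2.2
  have hin' : ∀ l, ¬ (i < l ∧ l < j) ∨ (i < ρ l ∧ ρ l < j) := fun l => by
    have := hin l
    tauto
  refine ⟨⟨?_, ?_⟩, ?_⟩
  · intro v
    simp only [ap]
    grind
  · intro p q hpq hqp hpp
    have sp : ∀ p, (p = i ∨ p = j ∨ p = ρ i ∨ p = ρ j) → (p = i ∧ surg ρ i j p = j) ∨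
        (p = j ∧ surg ρ i j p = i) ∨ (p = ρ i ∧ surg ρ i j p = ρ j) ∨
        (p = ρ j ∧ surg ρ i j p = ρ i) := by
      intro p hp
      rw [ap p]
      rcases hp with h | h | h | h
      · left; simp [h]
      · right; left; simp [h, hij.ne']
      · right; right; left; simp [h, hne, h3]
      · right; right; right; simp [h, h4, h5, h6.symm]
    have np : ∀ p, ¬ (p = i ∨ p = j ∨ p = ρ i ∨ p = ρ j) → surg ρ i j p = ρ p := by
      intro p hp
      push Not at hp
      obtain ⟨p1, p2, p3, p4⟩ := hp
      rw [ap p, if_neg p1, if_neg p2, if_neg p3, if_neg p4]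
    clear ap
    have sp1 := sp p
    have sp2 := sp q
    have np1 := np p
    have np2 := np q
    clear sp np
    generalize surg ρ i j p = P at *
    generalize surg ρ i j q = Q at *
    by_cases hp : p = i ∨ p = j ∨ p = ρ i ∨ p = ρ j
    · have sp1 := sp1 hp
      clear np1 hp
      by_cases hq : q = i ∨ q = j ∨ q = ρ i ∨ q = ρ j
      · have sp2 := sp2 hq
        clear hin hin' nc hinj hinv hf hρ np2 hq
        generalize ρ i = a at *
        generalize ρ j = b at *
        rcases oc with oc | oc | oc <;> rcases sp1 with h | h | h | h <;> omega
      · have np2 := np2 hq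
        clear sp2
        push Not at hq
        have f1 := hin' q
        have f2 := hin' (ρ q)
        rw [hinv q] at f2
        have g1 : ρ q ≠ i := fun h => hq.2.2.1 (hinj _ _ h)
        have g2 : ρ q ≠ j := fun h => hq.2.2.2 (hinj _ _ h)
        have g3 : ρ q ≠ ρ i := fun h => hq.1 (ρ.injective h)
        have g4 : ρ q ≠ ρ j := fun h => hq.2.1 (ρ.injective h)
        have f3 := nc i q
        have f7 := nc q (ρ i)
        rw [h1] at f7
        have f4 := nc j q
        have f5 := nc (ρ i) q
        have f6 := nc (ρ j) q
        rw [h1] at f5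
        rw [h2] at f6
        clear hin hin' nc hinj hinv hf hρ
        subst np2
        generalize ρ i = a at *
        generalize ρ j = b at *
        rcases oc with oc | oc | oc <;> rcases sp1 with h | h | h | h <;> omega
    · have np1 := np1 hp
      push Not at hp
      clear sp1
      by_cases hq : q = i ∨ q = j ∨ q = ρ i ∨ q = ρ j
      · have sp2 := sp2 hq
        clear np2 hq
        have f1 := hin' (ρ p)
        have f2 := hin' p
        have g1 : ρ p ≠ i := fun h => hp.2.2.1 (hinj _ _ h)
        have g2 : ρ p ≠ j := fun h => hp.2.2.2 (hinj _ _ h)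
        have g3 : ρ p ≠ ρ i := fun h => hp.1 (ρ.injective h)
        have g4 : ρ p ≠ ρ j := fun h => hp.2.1 (ρ.injective h)
        have f3 := nc p i
        have f7 := nc j p
        have f4 := nc p j
        have f5 := nc p (ρ i)
        have f6 := nc p (ρ j)
        rw [h1] at f5
        rw [h2] at f6
        rw [hinv p] at f1
        clear hin hin' nc hinj hinv hf hρ
        subst np1
        generalize ρ i = a at *
        generalize ρ j = b at *
        rcases oc with oc | oc | oc <;> rcases sp2 with h | h | h | h <;> omega
      · have np2 := np2 hq
        rw [np1] at hqp hpp
        rw [np2] at hpp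
        exact hρ.2 p q hpq hqp hpp
  · intro v
    have := hf v
    rw [ap]
    grind

/-- the matrix squares to one -/
def Sq (M : Bool → Bool → ℂ) : Prop := ∀ x z, ∑ y, M x y * M y z = if x = z then 1 else 0

lemma sq3 (M : Bool → Bool → ℂ) (hM : Sq M) (p q : Bool) :
    ∑ x, ∑ y, M p x * M x y * M y q = M p q := by
  have h : ∀ x, ∑ y, M p x * M x y * M y q = M p x * if x = q then 1 else 0 := by
    intro x
    rw [← hM x q, Finset.mul_sum]
    simp_rw [mul_assoc]
  rw [Finset.sum_congr rfl fun x _ => h x]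
  simp only [mul_ite, mul_one, mul_zero, Finset.sum_ite_eq', Finset.mem_univ, if_true]

lemma sq3' (M : Bool → Bool → ℂ) (hM : Sq M) (p q : Bool) :
    ∑ x, ∑ y, M p x * M x y * M q y = M q p := by
  have h := hM p
  have h1 := hM p p
  simp only [Sq, Fintype.sum_bool] at *
  have a1 := hM true true
  have a2 := hM true false
  have a3 := hM false true
  have a4 := hM false false
  cases p <;> cases q <;> simp at * <;> grind

lemma sq3'' (M : Bool → Bool → ℂ) (hM : Sq M) (p q : Bool) :
    ∑ x, ∑ y, M x p * M x y * M y q = M q p := by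
  have h := hM p
  simp only [Sq, Fintype.sum_bool] at *
  have a1 := hM true true
  have a2 := hM true false
  have a3 := hM false true
  have a4 := hM false false
  cases p <;> cases q <;> simp at * <;> grind

lemma Z_surg (M : Bool → Bool → ℂ) (hM : Sq M) (π ρ : Equiv.Perm (Fin N)) (hπ : INC π)
    (hρ : INC ρ) (hf : ∀ v, ρ v ≠ v)
    (i j : Fin N) (hij : i < j) (hπi : π i = j) (hne : ρ i ≠ j)
    (hin : ∀ l, i < l → l < j → i < ρ l ∧ ρ l < j) :
    Z M π (surg ρ i j) = dl M * Z M π ρ := by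
  classical
  have ap := surg_apply ρ hρ.1 hf i j hij.ne hne
  have oc := order_cases ρ hρ hf i j hij hne hin
  have hπj : π j = i := by rw [← hπi, hπ.1]
  have h1 := hρ.1 i
  have h2 := hρ.1 j
  have h3 := hf i
  have h4 := hf j
  have h5 : ρ j ≠ i := fun h => hne (by rw [← h, hρ.1])
  have h6 : ρ i ≠ ρ j := fun h => hij.ne (ρ.injective h)
  obtain ⟨a, ha⟩ : ∃ a, a = ρ i := ⟨_, rfl⟩
  obtain ⟨b, hb⟩ : ∃ b, b = ρ j := ⟨_, rfl⟩
  rw [← ha] at h1 h3 h6 hne oc ap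
  rw [← hb] at h2 h4 h5 h6 oc ap
  have si : surg ρ i j i = j := by rw [ap]; simp
  have sj : surg ρ i j j = i := by rw [ap]; simp [hij.ne']
  have sa : surg ρ i j a = b := by rw [ap]; simp [h3, hne]
  have sb : surg ρ i j b = a := by rw [ap]; simp [h5, h4, h6.symm]
  -- reduce to pointwise
  have red : ∀ f : (Fin N → Bool) → ℂ, ∑ s, ∑ x, ∑ y, f (Function.update (Function.update s i x) j y)
      = 4 * ∑ s, f s := by
    intro f
    rw [sum_update (fun s => ∑ y, f (Function.update s j y)) i, sum_update f j]
    ring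
  have : (4 : ℂ) * Z M π (surg ρ i j) = 4 * (dl M * Z M π ρ) := by
    rw [mul_left_comm]
    unfold Z
    rw [← red, ← red, Finset.mul_sum]
    apply Finset.sum_congr rfl
    intro s _
    have eπ : ∀ x y, vec M π (Function.update (Function.update s i x) j y)
        = M x y * ∏ l ∈ {i, j}ᶜ, psi M π s l := by
      intro x y
      rw [vec_split2 M π _ i j hij.ne hπi hπj]
      congr 1
      · simp [arc, hij, hij.ne]
      · apply Finset.prod_congr rfl
        intro l hl
        simp at hl
        unfold psi
        have : π l ≠ i := fun h => hl.2 (by rw [← hπi, ← h, hπ.1])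
        have : π l ≠ j := fun h => hl.1 (by rw [← hπj, ← h, hπ.1])
        simp [*]
    have eρ : ∀ x y, vec M ρ (Function.update (Function.update s i x) j y)
        = (arc M (Function.update (Function.update s i x) j y) i a *
          arc M (Function.update (Function.update s i x) j y) j b)
          * ∏ l ∈ {i, a, j, b}ᶜ, psi M ρ s l := by
      intro x y
      rw [vec_split4 M ρ _ i a j b (Ne.symm h3) ha.symm h1 h4.symm hb.symm h2 hij.ne h5.symm hne h6]
      congr 1
      · apply Finset.prod_congr rfl
        intro l hl
        simp at hl
        unfold psi
        have : ρ l ≠ i := fun h => hl.2.1 (by rw [ha, ← h, hρ.1])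
        have : ρ l ≠ j := fun h => hl.2.2.2 (by rw [hb, ← h, hρ.1])
        simp [*]
    have eσ : ∀ x y, vec M (surg ρ i j) (Function.update (Function.update s i x) j y)
        = M x y * arc M s a b * ∏ l ∈ {i, a, j, b}ᶜ, psi M ρ s l := by
      intro x y
      rw [vec_split4 M _ _ i j a b hij.ne si sj h6 sa sb h3.symm h5.symm hne.symm h4.symm]
      congr 1
      · congr 1
        · simp [arc, hij, hij.ne]
        · simp [arc, h3, h4, h5, h6, hne]
      · have : ({i, j, a, b} : Finset (Fin N)) = {i, a, j, b} := by
          ext l; simp; tauto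
        rw [this]
        apply Finset.prod_congr rfl
        intro l hl
        simp at hl
        unfold psi
        have : ρ l ≠ i := fun h => hl.2.1 (by rw [ha, ← h, hρ.1])
        have : ρ l ≠ j := fun h => hl.2.2.2 (by rw [hb, ← h, hρ.1])
        have : surg ρ i j l = ρ l := by rw [ap]; simp [hl]
        rw [this]
        simp only [Function.update_apply]
        simp [*]
    simp_rw [eπ, eρ, eσ]
    set R1 := ∏ l ∈ {i, j}ᶜ, psi M π s l
    set R2 := ∏ l ∈ {i, a, j, b}ᶜ, psi M ρ s l
    have L : ∑ x, ∑ y, M x y * R1 * (M x y * arc M s a b * R2) = dl M * (arc M s a b * R1 * R2) := by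
      simp only [dl, Fintype.sum_bool]; ring
    rw [L]
    congr 1
    have key : ∑ x, ∑ y, M x y * (arc M (Function.update (Function.update s i x) j y) i a *
          arc M (Function.update (Function.update s i x) j y) j b) = arc M s a b := by
      rcases oc with oc | oc | oc
      · have c1 : ¬ i < a := by omega
        have c2 : j < b := by omega
        have c3 : a < b := by omega
        rw [show arc M s a b = M (s a) (s b) by simp [arc, c3], ← sq3 M hM]
        refine Finset.sum_congr rfl fun x _ => Finset.sum_congr rfl fun y _ => ?_
        simp [arc, c1, c2, hij.ne, h3, h4, h5, hne]
        ring
      · have c1 : ¬ i < a := by omega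
        have c2 : ¬ j < b := by omega
        have c3 : ¬ a < b := by omega
        rw [show arc M s a b = M (s b) (s a) by simp [arc, c3], ← sq3' M hM]
        refine Finset.sum_congr rfl fun x _ => Finset.sum_congr rfl fun y _ => ?_
        simp [arc, c1, c2, hij.ne, h3, h4, h5, hne]
        ring
      · have c1 : i < a := by omega
        have c2 : j < b := by omega
        have c3 : ¬ a < b := by omega
        rw [show arc M s a b = M (s b) (s a) by simp [arc, c3], ← sq3'' M hM]
        refine Finset.sum_congr rfl fun x _ => Finset.sum_congr rfl fun y _ => ?_
        simp [arc, c1, c2, hij.ne, h3, h4, h5, hne]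
        ring
    rw [← key]
    simp only [Finset.sum_mul]
    refine Finset.sum_congr rfl fun x _ => Finset.sum_congr rfl fun y _ => ?_
    ring
  exact mul_left_cancel₀ (by norm_num) this

lemma Z_pow (π : Equiv.Perm (Fin N)) (hπ : INC π) (hπf : ∀ v, π v ≠ v) : ∀ (n : ℕ)
    (ρ : Equiv.Perm (Fin N)), INC ρ → (∀ v, ρ v ≠ v) →
    (Finset.univ.filter fun l => π l ≠ ρ l).card = n →
    ∃ k : ℤ, ∀ M, Sq M → dl M ≠ 0 → Z M π ρ = dl M ^ k := by
  classical
  intro n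
  induction n using Nat.strong_induction_on with
  | _ n ih =>
  intro ρ hρ hf hn
  by_cases heq : π = ρ
  · subst heq
    exact ⟨_, fun M _ _ => by rw [Z_self M π hπ hf, zpow_natCast]⟩
  have hex : (Finset.univ.filter fun l => l < π l ∧ π l ≠ ρ l).Nonempty := by
    by_contra hc
    rw [Finset.not_nonempty_iff_eq_empty, Finset.filter_eq_empty_iff] at hc
    apply heq
    ext1 l
    rcases lt_or_gt_of_ne (hπf l) with h | h
    · have := hc (Finset.mem_univ (π l))
      rw [hπ.1] at this
      have h' : l = ρ (π l) := by tauto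
      conv_rhs => rw [h']
      rw [hρ.1]
    · have := hc (Finset.mem_univ l)
      tauto
  obtain ⟨i, hi, hmax⟩ := Finset.exists_max_image _ id hex
  simp at hi
  obtain ⟨j, hj⟩ : ∃ j, j = π i := ⟨_, rfl⟩
  rw [← hj] at hi
  obtain ⟨hij, hne⟩ := hi
  have hmax' : ∀ l, i < l → l < π l → π l = ρ l := by
    intro l h1 h2
    by_contra hc
    have := hmax l (by simp [h2, hc])
    simp at this
    omega
  have hπj : π j = i := by rw [hj, hπ.1]
  have hin0 : ∀ l, i < l → l < j → i < π l ∧ π l < j := by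
    intro l h1 h2
    have n1 : π l ≠ i := fun h => by rw [← hπ.1 l, h, ← hj] at h2; exact lt_irrefl _ h2
    have n2 : π l ≠ j := fun h => by rw [← hπ.1 l, h, hπj] at h1; exact lt_irrefl _ h1
    constructor
    · by_contra hc
      exact hπ.2 (π l) i (by omega) (by rw [hπ.1]; exact h1) (by rw [hπ.1, ← hj]; exact h2)
    · by_contra hc
      exact hπ.2 i l h1 (by rw [← hj]; exact h2) (by rw [← hj]; omega)
  have hagree : ∀ l, i < l → l < j → π l = ρ l := by
    intro l h1 h2
    rcases lt_or_gt_of_ne (hπf l) with h | h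
    · have := hmax' (π l) (hin0 l h1 h2).1 (by rw [hπ.1]; exact h)
      rw [hπ.1] at this
      conv_rhs => rw [this]
      rw [hρ.1]
    · exact hmax' l h1 h
  have hin : ∀ l, i < l → l < j → i < ρ l ∧ ρ l < j := by
    intro l h1 h2
    rw [← hagree l h1 h2]
    exact hin0 l h1 h2
  have hs := surg_INC ρ hρ hf i j hij (Ne.symm hne) hin
  have ap := surg_apply ρ hρ.1 hf i j hij.ne (Ne.symm hne)
  have hlt : (Finset.univ.filter fun l => π l ≠ surg ρ i j l).card < n := by
    rw [← hn]
    apply Finset.card_lt_card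
    rw [Finset.ssubset_iff_of_subset]
    · refine ⟨i, by simp [← hj, hne], ?_⟩
      simp [ap, ← hj]
    · intro l
      simp only [Finset.mem_filter, Finset.mem_univ, true_and]
      intro hl hc
      apply hl
      rw [ap]
      have : l = ρ i → False := by
        intro h
        have : π l = i := by rw [hc, h, hρ.1]
        have : l = j := by rw [hj, ← this, hπ.1]
        exact hne (this ▸ h)
      have : l = ρ j → False := by
        intro h
        have : π l = j := by rw [hc, h, hρ.1]
        have : l = i := by rw [← hπj, ← this, hπ.1]
        exact hne (by rw [← hρ.1 j, ← h, this])
      grind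
  obtain ⟨k, hk⟩ := ih _ hlt (surg ρ i j) hs.1 hs.2 rfl
  refine ⟨k - 1, fun M hM hd => ?_⟩
  have e := hk M hM hd
  rw [Z_surg M hM π ρ hπ hρ hf i j hij hj.symm (Ne.symm hne) hin] at e
  rw [zpow_sub_one₀ hd, ← e]
  field_simp

lemma Z_loop (π ρ : Equiv.Perm (Fin N)) (hπ : INC π) (hπf : ∀ v, π v ≠ v)
    (hρ : INC ρ) (hρf : ∀ v, ρ v ≠ v) (M : Bool → Bool → ℂ) (hM : Sq M) (hd : dl M ≠ 0) :
    Z M π ρ = dl M ^ Nat.card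
      (SimpleGraph.fromRel fun v w => π v = w ∨ ρ v = w).ConnectedComponent := by
  obtain ⟨k, hk⟩ := Z_pow π hπ hπf _ ρ hρ hρf rfl
  have h2 : dl idM = 2 := by
    simp [dl, idM]
  have h1 := hk idM (by intro x z; cases x <;> cases z <;> simp [idM]) (by rw [h2]; norm_num)
  rw [Z_idM π ρ hπ.1 hρ.1, h2, ← zpow_natCast] at h1
  have : ((Nat.card (SimpleGraph.fromRel fun v w => π v = w ∨ ρ v = w).ConnectedComponent : ℕ) : ℤ) = k := by
    have h3 : ((2 : ℝ) ^ ((Nat.card (SimpleGraph.fromRel fun v w => π v = w ∨ ρ v = w).ConnectedComponent : ℕ) : ℤ)) = 2 ^ k := by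
      have h4 := congrArg norm h1
      rw [norm_zpow, norm_zpow] at h4
      simpa using h4
    exact zpow_right_injective₀ (by norm_num) (by norm_num) h3
  rw [hk M hM hd, ← this, zpow_natCast]

/-- the arc matrix -/
noncomputable def tm (t : ℂ) : Bool → Bool → ℂ := fun x y => if x = y then 0 else if x then t else t⁻¹

lemma tm_Sq (t : ℂ) (ht : t ≠ 0) : Sq (tm t) := by
  intro x z
  cases x <;> cases z <;> simp [tm, ht]

lemma tm_ne (t : ℂ) (ht : t ≠ 0) (x y : Bool) : tm t x y ≠ 0 ↔ y = !x := by
  cases x <;> cases y <;> simp [tm, ht]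

/-- site factor -/
noncomputable def phi (t : ℂ) (τ : Equiv.Perm (Fin N)) (r s : Fin N → Bool) (l : Fin N) : ℂ :=
  if l < τ l then tm t (s l) (s (τ l)) else
    if τ l = l then (if s l = r l then 1 else 0) else 1

/-- partial vector -/
noncomputable def uu (t : ℂ) (τ : Equiv.Perm (Fin N)) (r s : Fin N → Bool) : ℂ := ∏ l, phi t τ r s l

lemma uu_ne {t : ℂ} (ht : t ≠ 0) {τ : Equiv.Perm (Fin N)} (hτ : ∀ v, τ (τ v) = v)
    {r s : Fin N → Bool} (T : Finset (Fin N)) (hT : ∀ l ∈ T, τ l ∈ T)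
    (h : ∏ l ∈ T, phi t τ r s l ≠ 0) :
    (∀ l ∈ T, τ l ≠ l → s (τ l) = !s l) ∧ (∀ l ∈ T, τ l = l → s l = r l) := by
  rw [Finset.prod_ne_zero_iff] at h
  constructor
  · intro l hl hne
    rcases lt_or_gt_of_ne hne with h1 | h1
    · have := h (τ l) (hT l hl)
      unfold phi at this
      rw [hτ, if_pos h1, tm_ne t ht] at this
      rw [this]; simp
    · have := h l hl
      unfold phi at this
      rw [if_pos h1, tm_ne t ht] at this
      exact this
  · intro l hl he
    have := h l hl
    unfold phi at this
    rw [he] at this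
    simpa using this

/-- local weight -/
noncomputable def kk (κ : ℂ) (b : Bool) : ℂ := if b then κ else κ⁻¹

lemma kk_mul (κ : ℂ) (hκ : κ ≠ 0) (b : Bool) : kk κ b * kk κ (!b) = 1 := by
  cases b <;> simp [kk, hκ]

lemma kk_bal (κ : ℂ) (hκ : κ ≠ 0) {τ : Equiv.Perm (Fin N)} (hτ : ∀ v, τ (τ v) = v)
    (s : Fin N → Bool) (T : Finset (Fin N)) (hT : ∀ l ∈ T, τ l ∈ T) 
    (hs : ∀ l ∈ T, s (τ l) = !s l) : ∏ l ∈ T, kk κ (s l) = 1 := by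
  apply Finset.prod_involution (fun l _ => τ l)
  · intro l hl
    rw [hs l hl, kk_mul κ hκ]
  · intro l hl _ he
    have := hs l hl
    rw [he] at this
    simp at this
  · intro l hl
    exact hT l hl
  · intro l _
    exact hτ l

/-- flip a site -/
def fl (s : Fin N → Bool) (i : Fin N) : Fin N → Bool := Function.update s i (!s i)

/-- product of the weights to the left -/
noncomputable def HH (κ : ℂ) (s : Fin N → Bool) (i : Fin N) : ℂ := ∏ l ∈ Finset.Iio i, kk κ (s l)

lemma INC.closed {τ : Equiv.Perm (Fin N)} (h : INC τ) {i l : Fin N} (h1 : i < l) (h2 : l < τ i) :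
    i < τ l ∧ τ l < τ i := by
  have n1 : τ l ≠ i := fun h' => by rw [← h.1 l, h'] at h2; exact lt_irrefl _ h2
  have n2 : τ l ≠ τ i := fun h' => by rw [τ.injective h'] at h1; exact lt_irrefl _ h1
  constructor
  · by_contra hc
    exact h.2 (τ l) i (by omega) (by rw [h.1]; exact h1) (by rw [h.1]; exact h2)
  · by_contra hc
    exact h.2 i l h1 h2 (by omega)

lemma arc_cancel {t κ : ℂ} (ht : t ≠ 0) (hκ : κ = -t⁻¹ ^ 2) {τ : Equiv.Perm (Fin N)} (h : INC τ)
    (hn : NFU τ) (r s : Fin N → Bool) (b : Bool) (i : Fin N) (hi : i < τ i) :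
    (if s i = b then HH κ s i * uu t τ r (fl s i) else 0) +
    (if s (τ i) = b then HH κ s (τ i) * uu t τ r (fl s (τ i)) else 0) = 0 := by
  classical
  have hκ0 : κ ≠ 0 := by rw [hκ]; simp [ht]
  obtain ⟨j, hj⟩ : ∃ j, j = τ i := ⟨_, rfl⟩
  have hτj : τ j = i := by rw [hj, h.1]
  rw [← hj] at hi ⊢
  have split : ∀ s', uu t τ r s' = tm t (s' i) (s' j) * ∏ l ∈ {i, j}ᶜ, phi t τ r s' l := by
    intro s'
    unfold uu
    rw [← Finset.prod_mul_prod_compl {i, j}, Finset.prod_pair hi.ne]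
    congr 1
    simp [phi, ← hj, hi, hτj, not_lt.mpr hi.le, hi.ne]
  have hcl : ∀ l ∈ ({i, j}ᶜ : Finset (Fin N)), τ l ∈ ({i, j}ᶜ : Finset (Fin N)) := by
    intro l hl
    simp at hl ⊢
    constructor
    · intro h'; exact hl.2 (by rw [hj, ← h', h.1])
    · intro h'; exact hl.1 (by rw [← hτj, ← h', h.1])
  have rest : ∀ k, (k = i ∨ k = j) → ∏ l ∈ {i, j}ᶜ, phi t τ r (fl s k) l
      = ∏ l ∈ {i, j}ᶜ, phi t τ r s l := by
    intro k hk
    apply Finset.prod_congr rfl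
    intro l hl
    have h1 := hl
    have h2 := hcl l hl
    simp at h1 h2
    have h3 : l ≠ k := by rcases hk with rfl | rfl; exacts [h1.1, h1.2]
    have h4 : τ l ≠ k := by rcases hk with rfl | rfl; exacts [h2.1, h2.2]
    simp [phi, fl, h3, h4]
  rw [split, split, rest i (Or.inl rfl), rest j (Or.inr rfl)]
  by_cases hR : ∏ l ∈ {i, j}ᶜ, phi t τ r s l = 0
  · rw [hR]; simp
  by_cases hs : s i = s j
  swap
  · have e1 : tm t (fl s i i) (fl s i j) = 0 := by
      by_contra hc
      rw [← ne_eq, tm_ne t ht] at hc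
      simp [fl, hi.ne'] at hc
      exact hs hc.symm
    have e2 : tm t (fl s j i) (fl s j j) = 0 := by
      by_contra hc
      rw [← ne_eq, tm_ne t ht] at hc
      simp [fl, hi.ne] at hc
      exact hs hc.symm
    rw [e1, e2]; simp
  rw [← hs]
  by_cases hb : s i = b
  swap
  · simp [hb]
  rw [if_pos hb, if_pos hb]
  have hH : HH κ s j = HH κ s i * kk κ b := by
    unfold HH
    have : Finset.Iio j = Finset.Iio i ∪ ({i} ∪ Finset.Ioo i j) := by
      ext l; simp; omega
    rw [this, Finset.prod_union, Finset.prod_union]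
    · rw [Finset.prod_singleton, hb]
      rw [kk_bal κ hκ0 h.1 s (Finset.Ioo i j), mul_one]
      · intro l hl
        rw [Finset.mem_Ioo] at hl ⊢
        rw [hj] at hl ⊢
        exact h.closed hl.1 hl.2
      · intro l hl
        rw [Finset.mem_Ioo] at hl
        apply (uu_ne ht h.1 _ hcl hR).1 l
        · simp; omega
        · exact hn i l hl.1 (hj ▸ hl.2)
    · rw [Finset.disjoint_left]; intro l; simp; omega
    · rw [Finset.disjoint_left]; intro l; simp; omega
  rw [hH]
  have e1 : tm t (fl s i i) (fl s i j) = tm t (!b) b := by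
    simp [fl, hi.ne', ← hs, hb]
  have e2 : tm t (fl s j i) (fl s j j) = tm t b (!b) := by
    simp [fl, hi.ne, ← hs, hb]
  rw [e1, e2]
  have : tm t (!b) b + kk κ b * tm t b (!b) = 0 := by
    cases b <;> simp [tm, kk, hκ] <;> field_simp <;> ring
  linear_combination (HH κ s i * ∏ l ∈ {i, j}ᶜ, phi t τ r s l) * this

lemma arcs_cancel {t κ : ℂ} (ht : t ≠ 0) (hκ : κ = -t⁻¹ ^ 2) {τ : Equiv.Perm (Fin N)} (h : INC τ)
    (hn : NFU τ) (r s : Fin N → Bool) (b : Bool) :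
    ∑ i with τ i ≠ i, (if s i = b then HH κ s i * uu t τ r (fl s i) else 0) = 0 := by
  classical
  apply Finset.sum_involution (fun l _ => τ l)
  · intro i hi
    simp at hi
    rcases lt_or_gt_of_ne hi with h1 | h1
    · have := arc_cancel ht hκ h hn r s b (τ i) (by rw [h.1]; exact h1)
      rw [h.1] at this
      rw [add_comm]; exact this
    · exact arc_cancel ht hκ h hn r s b i h1
  · intro i hi _
    simpa using hi
  · intro i hi
    simp at hi ⊢
    intro h'; exact hi h'
  · intro i _
    exact h.1 i

/-- raising operator kills -/
def KerE (κ : ℂ) (x : (Fin N → Bool) → ℂ) : Prop :=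
  ∀ s, ∑ i, (if s i = true then HH κ s i * x (fl s i) else 0) = 0

lemma fl_fl (s : Fin N → Bool) (i : Fin N) : fl (fl s i) i = s := by
  simp [fl]

lemma HH_fl (κ : ℂ) (s : Fin N → Bool) (i : Fin N) : HH κ (fl s i) i = HH κ s i := by
  unfold HH
  apply Finset.prod_congr rfl
  intro l hl
  simp at hl
  simp [fl, hl.ne]

lemma transpose (κ : ℂ) (x u : (Fin N → Bool) → ℂ) (hx : KerE κ x) :
    ∑ s, x s * ∑ i, (if s i = false then HH κ s i * u (fl s i) else 0) = 0 := by
  have h1 : ∑ s, (∑ i, (if s i = true then HH κ s i * x (fl s i) else 0)) * u s = 0 := by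
    apply Finset.sum_eq_zero
    intro s _
    rw [hx s, zero_mul]
  refine Eq.trans ?_ h1
  simp_rw [Finset.mul_sum, Finset.sum_mul]
  rw [Finset.sum_comm]
  conv_rhs => rw [Finset.sum_comm]
  apply Finset.sum_congr rfl
  intro i _
  apply Finset.sum_nbij' (fun s => fl s i) (fun s => fl s i)
  · simp
  · simp
  · intro s _; exact fl_fl s i
  · intro s _; exact fl_fl s i
  · intro s _
    rw [HH_fl, fl_fl]
    cases h : s i <;> simp [fl, h]
    ring

/-- contraction -/
noncomputable def yy (t : ℂ) (x : (Fin N → Bool) → ℂ) (τ : Equiv.Perm (Fin N)) (r : Fin N → Bool) : ℂ :=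
  ∑ s, x s * uu t τ r s

lemma uu_fl (t : ℂ) (τ : Equiv.Perm (Fin N)) (hτ : ∀ v, τ (τ v) = v) (r s : Fin N → Bool) (i : Fin N) (hi : τ i = i) :
    uu t τ r (fl s i) = uu t τ (fl r i) s := by
  unfold uu
  apply Finset.prod_congr rfl
  intro l _
  unfold phi
  by_cases hl : l = i
  · subst hl
    simp [hi, fl]
  · have : τ l ≠ i := fun h => hl (by rw [← hτ l, h, hi])
    simp [fl, hl, this]

lemma R2 {t κ : ℂ} (ht : t ≠ 0) (hκ : κ = -t⁻¹ ^ 2) {τ : Equiv.Perm (Fin N)} (h : INC τ)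
    (hn : NFU τ) (x : (Fin N → Bool) → ℂ) (hx : KerE κ x) (r : Fin N → Bool) :
    ∑ i with τ i = i, (if r i = true then
      (∏ l with l < i ∧ τ l = l, kk κ (r l)) * yy t x τ (fl r i) else 0) = 0 := by
  classical
  have hκ0 : κ ≠ 0 := by rw [hκ]; simp [ht]
  have h0 := transpose κ x (uu t τ r) hx
  refine Eq.trans ?_ h0
  have : ∀ s, ∑ i, (if s i = false then HH κ s i * uu t τ r (fl s i) else 0)
      = ∑ i with τ i = i, (if r i = true then
      (∏ l with l < i ∧ τ l = l, kk κ (r l)) * uu t τ (fl r i) s else 0) := by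
    intro s
    rw [← Finset.sum_filter_add_sum_filter_not Finset.univ (fun i => τ i = i)]
    rw [arcs_cancel ht hκ h hn r s false, add_zero]
    apply Finset.sum_congr rfl
    intro i hi
    simp at hi
    rw [uu_fl t τ h.1 r s i hi]
    by_cases hu : uu t τ (fl r i) s = 0
    · simp [hu]
    obtain ⟨u1, u2⟩ := uu_ne ht h.1 Finset.univ (by simp) hu
    have e : s i = !r i := by
      rw [u2 i (Finset.mem_univ _) hi]; simp [fl]
    rw [e]
    cases hr : r i
    · simp
    simp only [Bool.not_true, if_true]
    congr 1
    unfold HH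
    rw [← Finset.prod_filter_mul_prod_filter_not (Finset.Iio i) (fun l => τ l = l)]
    rw [kk_bal κ hκ0 h.1 s ((Finset.Iio i).filter fun l => ¬ τ l = l), mul_one]
    · have : (Finset.univ.filter fun l => l < i ∧ τ l = l) = (Finset.Iio i).filter fun l => τ l = l := by
        ext l; simp
      rw [this]
      apply Finset.prod_congr rfl
      intro l hl
      simp at hl
      rw [u2 l (Finset.mem_univ _) hl.2]
      simp [fl, hl.1.ne]
    · intro l hl
      simp at hl ⊢
      refine ⟨?_, fun h' => hl.2 h'⟩
      by_contra hc
      have : τ l ≠ i := fun h' => hl.1.ne (by rw [← h.1 l, h', hi])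
      exact hn l i hl.1 (by omega) hi
    · intro l hl
      simp at hl
      exact u1 l (Finset.mem_univ _) hl.2
  simp_rw [this]
  simp_rw [Finset.mul_sum]
  rw [Finset.sum_comm]
  apply Finset.sum_congr rfl
  intro i _
  split_ifs
  · unfold yy
    rw [Finset.mul_sum]
    apply Finset.sum_congr rfl
    intro s _
    ring
  · simp

lemma R1 {t κ : ℂ} (ht : t ≠ 0) (hκ : κ = -t⁻¹ ^ 2) {τ : Equiv.Perm (Fin N)} (h : INC τ)
    (x : (Fin N → Bool) → ℂ) (i j : Fin N) (hij : i < j) (hi : τ i = i)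
    (hj : τ j = j) (r : Fin N → Bool)
    (h0 : yy t x (τ * Equiv.swap i j) r = 0) :
    yy t x τ (Function.update (Function.update r i true) j false) =
      κ * yy t x τ (Function.update (Function.update r i false) j true) := by
  classical
  have sl : ∀ l, l ≠ i → l ≠ j → (τ * Equiv.swap i j) l = τ l := by
    intro l h1 h2
    simp [Equiv.swap_apply_of_ne_of_ne h1 h2]
  have key : ∀ s, uu t (τ * Equiv.swap i j) r s =
      t * uu t τ (Function.update (Function.update r i true) j false) s +
      t⁻¹ * uu t τ (Function.update (Function.update r i false) j true) s := by
    intro s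
    have rest : ∀ a b, ∏ l ∈ {i, j}ᶜ, phi t τ (Function.update (Function.update r i a) j b) s l
        = ∏ l ∈ {i, j}ᶜ, phi t (τ * Equiv.swap i j) r s l := by
      intro a b
      apply Finset.prod_congr rfl
      intro l hl
      simp at hl
      unfold phi
      rw [sl l hl.1 hl.2]
      simp [hl]
    unfold uu
    rw [← Finset.prod_mul_prod_compl {i, j}, ← Finset.prod_mul_prod_compl {i, j},
      ← Finset.prod_mul_prod_compl {i, j} (phi t τ (Function.update (Function.update r i false) j true) s), rest, rest]
    rw [Finset.prod_pair hij.ne, Finset.prod_pair hij.ne, Finset.prod_pair hij.ne]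
    simp only [← mul_assoc, ← add_mul]
    congr 1
    have e1 : (τ * Equiv.swap i j) i = j := by simp [hj]
    have e2 : (τ * Equiv.swap i j) j = i := by simp [hi]
    unfold phi
    rw [e1, e2, hi, hj]
    cases h1 : s i <;> cases h2 : s j <;> simp [tm, hij, hij.ne, not_lt.mpr hij.le]
  unfold yy at h0
  simp_rw [key, mul_add, Finset.sum_add_distrib] at h0
  have e : t * yy t x τ (Function.update (Function.update r i true) j false) +
      t⁻¹ * yy t x τ (Function.update (Function.update r i false) j true) = 0 := by
    rw [← h0]
    unfold yy
    rw [Finset.mul_sum, Finset.mul_sum]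
    congr 1 <;> exact Finset.sum_congr rfl fun s _ => by ring
  rw [hκ]
  field_simp at e ⊢
  linear_combination e

lemma add_arc {τ : Equiv.Perm (Fin N)} (h : INC τ) (hn : NFU τ) (i j : Fin N) (hij : i < j)
    (hi : τ i = i) (hj : τ j = j) (hc : ∀ l, i < l → l < j → τ l ≠ l) :
    INC (τ * Equiv.swap i j) ∧ NFU (τ * Equiv.swap i j) ∧
    (Finset.univ.filter fun l => (τ * Equiv.swap i j) l = l).card <
      (Finset.univ.filter fun l => τ l = l).card := by
  classical
  have sl : ∀ l, l ≠ i → l ≠ j → (τ * Equiv.swap i j) l = τ l := by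
    intro l h1 h2
    simp [Equiv.swap_apply_of_ne_of_ne h1 h2]
  have e1 : (τ * Equiv.swap i j) i = j := by simp [hj]
  have e2 : (τ * Equiv.swap i j) j = i := by simp [hi]
  have ni : ∀ l, l ≠ i → τ l ≠ i := fun l h1 h2 => h1 (by rw [← h.1 l, h2, hi])
  have nj : ∀ l, l ≠ j → τ l ≠ j := fun l h1 h2 => h1 (by rw [← h.1 l, h2, hj])
  generalize τ * Equiv.swap i j = σ at *
  refine ⟨⟨?_, ?_⟩, ?_, ?_⟩
  · intro l
    by_cases h1 : l = i
    · rw [h1, e1, e2]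
    by_cases h2 : l = j
    · rw [h2, e2, e1]
    rw [sl l h1 h2, sl _ (ni l h1) (nj l h2), h.1]
  · intro a b hab hba hs
    by_cases a1 : a = i
    · subst a1
      rw [e1] at hba hs
      have hb := sl b hab.ne' hba.ne
      rw [hb] at hs
      exact hn b j hba hs hj
    by_cases a2 : a = j
    · subst a2
      rw [e2] at hba hs
      omega
    rw [sl a a1 a2] at hba hs
    by_cases b1 : b = i
    · subst b1
      exact hn a b hab hba hi
    by_cases b2 : b = j
    · subst b2
      exact hn a b hab hba hj
    rw [sl b b1 b2] at hs
    exact h.2 a b hab hba hs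
  · intro a b hab hba hs
    have b1 : b ≠ i := by rintro rfl; rw [e1] at hs; omega
    have b2 : b ≠ j := by rintro rfl; rw [e2] at hs; omega
    rw [sl b b1 b2] at hs
    by_cases a1 : a = i
    · subst a1
      rw [e1] at hba
      exact hc b hab hba hs
    by_cases a2 : a = j
    · subst a2
      rw [e2] at hba
      omega
    rw [sl a a1 a2] at hba
    exact hn a b hab hba hs
  · apply Finset.card_lt_card
    rw [Finset.ssubset_iff_of_subset]
    · exact ⟨i, by simp [hi], by simp [e1, hij.ne']⟩
    · intro l
      simp only [Finset.mem_filter, Finset.mem_univ, true_and]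
      intro hs
      have b1 : l ≠ i := by rintro rfl; rw [e1] at hs; omega
      have b2 : l ≠ j := by rintro rfl; rw [e2] at hs; omega
      rw [← sl l b1 b2]; exact hs

/-- weight zero -/
def Wt0 (κ : ℂ) (x : (Fin N → Bool) → ℂ) : Prop := ∀ s, x s ≠ 0 → ∏ l, kk κ (s l) = 1

lemma R3 {t κ : ℂ} (ht : t ≠ 0) (hκ0 : κ ≠ 0) (hroot : ∀ m : ℕ, 0 < m → κ ^ m ≠ 1)
    {τ : Equiv.Perm (Fin N)} (h : INC τ) (hne : (Finset.univ.filter fun l => τ l = l).Nonempty)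
    (x : (Fin N → Bool) → ℂ) (hx : Wt0 κ x) (r : Fin N → Bool) (hr : ∀ l, τ l = l → r l = true) :
    yy t x τ r = 0 := by
  classical
  unfold yy
  apply Finset.sum_eq_zero
  intro s _
  by_contra hc
  obtain ⟨h1, h2⟩ := mul_ne_zero_iff.mp hc
  obtain ⟨u1, u2⟩ := uu_ne ht h.1 Finset.univ (by simp) h2
  have h3 := hx s h1
  rw [← Finset.prod_filter_mul_prod_filter_not Finset.univ (fun l => τ l = l),
    kk_bal κ hκ0 h.1 s (Finset.univ.filter fun l => ¬ τ l = l), mul_one] at h3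
  · rw [Finset.prod_congr rfl (g := fun _ => κ), Finset.prod_const] at h3
    · exact hroot _ (Finset.card_pos.mpr hne) h3
    · intro l hl
      simp at hl
      rw [u2 l (Finset.mem_univ _) hl, hr l hl]; simp [kk]
  · intro l hl
    simp at hl ⊢
    intro h'; exact hl h'
  · intro l hl
    simp at hl
    exact u1 l (Finset.mem_univ _) hl

lemma sum_rank (g : ℕ → ℂ) (S : Finset (Fin N)) :
    ∑ i ∈ S, g (S.filter fun l => l < i).card = ∑ m ∈ Finset.range S.card, g m := by
  classical
  induction S using Finset.induction_on_max with
  | empty => simp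
  | insert a S ha ih =>
    have hn : a ∉ S := fun h => lt_irrefl _ (ha a h)
    rw [Finset.sum_insert hn, Finset.card_insert_of_notMem hn, Finset.sum_range_succ, add_comm]
    congr 1
    · rw [← ih]
      apply Finset.sum_congr rfl
      intro i hi
      congr 2
      rw [Finset.filter_insert, if_neg (not_lt.mpr (ha i hi).le)]
    · congr 2
      rw [Finset.filter_insert, if_neg (lt_irrefl _), Finset.filter_true_of_mem ha]

lemma yy_zero {t κ : ℂ} (ht : t ≠ 0) (hκ : κ = -t⁻¹ ^ 2) (hroot : ∀ m : ℕ, 0 < m → κ ^ m ≠ 1)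
    (x : (Fin N → Bool) → ℂ) (hx : KerE κ x) (hw : Wt0 κ x)
    (hp : ∀ π : Equiv.Perm (Fin N), INC π → (∀ v, π v ≠ v) → ∑ s, x s * vec (tm t) π s = 0) :
    ∀ (n : ℕ) (τ : Equiv.Perm (Fin N)), INC τ → NFU τ →
      (Finset.univ.filter fun l => τ l = l).card = n → ∀ r, yy t x τ r = 0 := by
  classical
  have hκ0 : κ ≠ 0 := by rw [hκ]; simp [ht]
  intro n
  induction n using Nat.strong_induction_on with
  | _ n ih =>
  intro τ h hn hcard
  by_cases hne : (Finset.univ.filter fun l => τ l = l).Nonempty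
  swap
  · intro r
    rw [Finset.not_nonempty_iff_eq_empty, Finset.filter_eq_empty_iff] at hne
    have hf : ∀ v, τ v ≠ v := fun v => hne (Finset.mem_univ v)
    rw [← hp τ h hf]
    unfold yy
    apply Finset.sum_congr rfl
    intro s _
    congr 1
    unfold uu vec
    apply Finset.prod_congr rfl
    intro l _
    simp [phi, psi, hf]
  have step : ∀ (i j : Fin N), i < j → τ i = i → τ j = j → (∀ l, i < l → l < j → τ l ≠ l) →
      ∀ r, yy t x τ (Function.update (Function.update r i true) j false) =
      κ * yy t x τ (Function.update (Function.update r i false) j true) := by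
    intro i j hij hi hj hc r
    obtain ⟨a1, a2, a3⟩ := add_arc h hn i j hij hi hj hc
    exact R1 ht hκ h x i j hij hi hj r (ih _ (hcard ▸ a3) _ a1 a2 rfl r)
  by_contra hcon
  push Not at hcon
  have hS : (Finset.univ.filter fun r => yy t x τ r ≠ 0).Nonempty := by
    obtain ⟨r, hr⟩ := hcon
    exact ⟨r, by simp [hr]⟩
  obtain ⟨r, hr, hmax⟩ := Finset.exists_max_image _
    (fun r : Fin N → Bool => ∑ l : Fin N, if r l then (l : ℕ) else 0) hS
  simp only [Finset.mem_filter, Finset.mem_univ, true_and] at hr hmax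
  -- no fixed consecutive pair (+,-)
  have nocons : ∀ i j, i < j → τ i = i → τ j = j → (∀ l, i < l → l < j → τ l ≠ l) →
      r i = true → r j = true := by
    intro i j hij hi hj hc hri
    by_contra hrj
    simp at hrj
    have e1 : Function.update (Function.update r i true) j false = r := by
      funext l
      simp only [Function.update_apply]
      split_ifs with h1 h2
      · rw [h1, hrj]
      · rw [h2, hri]
      · rfl
    have e := step i j hij hi hj hc r
    rw [e1] at e
    have hne2 : yy t x τ (Function.update (Function.update r i false) j true) ≠ 0 := by
      intro h0; rw [h0, mul_zero] at e; exact hr e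
    have hle := hmax _ hne2
    have f : ∀ r' : Fin N → Bool, (∑ l : Fin N, if r' l then (l : ℕ) else 0)
      = (if r' i then (i : ℕ) else 0) + (if r' j then (j : ℕ) else 0) +
        ∑ l ∈ {i, j}ᶜ, if r' l then (l : ℕ) else 0 := by
      intro r'
      rw [← Finset.sum_add_sum_compl {i, j}, Finset.sum_pair hij.ne]
    rw [f, f r] at hle
    have g : ∑ l ∈ {i, j}ᶜ, (if (Function.update (Function.update r i false) j true) l then (l : ℕ) else 0)
      = ∑ l ∈ {i, j}ᶜ, if r l then (l : ℕ) else 0 := by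
      apply Finset.sum_congr rfl
      intro l hl
      simp at hl
      simp [hl]
    rw [g] at hle
    simp [hij.ne, hri, hrj] at hle
    omega
  -- last minus
  have hm : (Finset.univ.filter fun l => τ l = l ∧ r l = false).Nonempty := by
    by_contra hc
    rw [Finset.not_nonempty_iff_eq_empty, Finset.filter_eq_empty_iff] at hc
    apply hr
    apply R3 ht hκ0 hroot h hne x hw r
    intro l hl
    have := hc (Finset.mem_univ l)
    simp [hl] at this
    exact this
  obtain ⟨i0, hi0, hi0max⟩ := Finset.exists_max_image _ id hm
  simp only [Finset.mem_filter, Finset.mem_univ, true_and, id] at hi0 hi0max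
  obtain ⟨hi0f, hi0r⟩ := hi0
  have hafter : ∀ l, τ l = l → i0 < l → r l = true := by
    intro l h1 h2
    by_contra hc
    simp at hc
    exact absurd (hi0max l ⟨h1, hc⟩) (not_le.mpr h2)
  have hbefore : ∀ l, τ l = l → l < i0 → r l = false := by
    intro l h1 h2
    by_contra hc
    simp at hc
    have hne1 : (Finset.univ.filter fun l => τ l = l ∧ r l = true ∧ l < i0).Nonempty :=
      ⟨l, by simp [h1, h2, hc]⟩
    obtain ⟨i1, hi1, hi1max⟩ := Finset.exists_max_image _ id hne1
    simp only [Finset.mem_filter, Finset.mem_univ, true_and, id] at hi1 hi1max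
    have hne2 : (Finset.univ.filter fun l => τ l = l ∧ i1 < l).Nonempty :=
      ⟨i0, by simp [hi0f, hi1]⟩
    obtain ⟨j, hj, hjmin⟩ := Finset.exists_min_image _ id hne2
    simp only [Finset.mem_filter, Finset.mem_univ, true_and, id] at hj hjmin
    have hrj := nocons i1 j hj.2 hi1.1 hj.1 (by
      intro l a1 a2 a3
      exact absurd (hjmin l ⟨a3, a1⟩) (not_le.mpr a2)) hi1.2.1
    have hji0 := hjmin i0 ⟨hi0f, hi1.2.2⟩
    have : j ≠ i0 := by rintro rfl; rw [hi0r] at hrj; exact absurd hrj (by simp)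
    exact absurd (hi1max j ⟨hj.1, hrj, lt_of_le_of_ne hji0 this⟩) (not_le.mpr hj.2)
  set r' := Function.update r i0 true with hr'
  set S := Finset.univ.filter (fun l => τ l = l ∧ i0 ≤ l) with hSdef
  have hr'S : ∀ l ∈ S, r' l = true := by
    intro l hl
    simp [hSdef] at hl
    rw [hr', Function.update_apply]
    split_ifs with h1
    · rfl
    · exact hafter l hl.1 (lt_of_le_of_ne hl.2 (Ne.symm h1))
  have claim : ∀ (m : ℕ) (i : Fin N), i ∈ S → (S.filter fun l => l < i).card = m →
      yy t x τ (fl r' i) = κ ^ m * yy t x τ r := by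
    intro m
    induction m with
    | zero =>
      intro i hi hc
      rw [Finset.card_eq_zero, Finset.filter_eq_empty_iff] at hc
      have h1 : ¬ i0 < i := hc (by simp [hSdef, hi0f])
      simp [hSdef] at hi
      have : i = i0 := by omega
      subst this
      have : fl r' i = r := by
        simp [fl, hr', ← hi0r]
      rw [this]; simp
    | succ m ihm =>
      intro i hi hc
      have hne3 : (S.filter fun l => l < i).Nonempty := by
        rw [← Finset.card_pos]; omega
      obtain ⟨p, hp1, hpmax⟩ := Finset.exists_max_image _ id hne3
      simp only [Finset.mem_filter, id] at hp1 hpmax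
      have hpc : (S.filter fun l => l < p).card = m := by
        have : (S.filter fun l => l < i) = insert p (S.filter fun l => l < p) := by
          ext l
          simp only [Finset.mem_filter, Finset.mem_insert]
          constructor
          · rintro ⟨a1, a2⟩
            rcases lt_or_eq_of_le (hpmax l ⟨a1, a2⟩) with h1 | h1
            · exact Or.inr ⟨a1, h1⟩
            · exact Or.inl h1
          · rintro (rfl | ⟨a1, a2⟩)
            · exact hp1
            · exact ⟨a1, a2.trans hp1.2⟩
        rw [this, Finset.card_insert_of_notMem (by simp)] at hc
        omega
      have e := ihm p hp1.1 hpc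
      have hpS := hp1.1
      have hiS := hi
      simp [hSdef] at hpS hiS
      have st := step p i hp1.2 hpS.1 hiS.1 (by
        intro l a1 a2 a3
        exact absurd (hpmax l ⟨by simp [hSdef, a3]; omega, a2⟩) (not_le.mpr a1)) r'
      have e1 : Function.update (Function.update r' p true) i false = fl r' i := by
        funext l
        simp only [fl, Function.update_apply, hr'S i hi]
        split_ifs with h1 h2
        · rfl
        · rw [h2, hr'S p hp1.1]
        · rfl
      have e2 : Function.update (Function.update r' p false) i true = fl r' p := by
        funext l
        simp only [fl, Function.update_apply, hr'S p hp1.1]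
        split_ifs with h1 h2 h3
        · rw [← h2, h1] at hp1; exact absurd hp1.2 (lt_irrefl _)
        · rw [h1, hr'S i hi]
        · rfl
        · rfl
      rw [e1, e2, e] at st
      rw [st]; ring
  have r2 := R2 ht hκ h hn x hx r'
  have e3 : ∑ i with τ i = i, (if r' i = true then
      (∏ l with l < i ∧ τ l = l, kk κ (r' l)) * yy t x τ (fl r' i) else 0)
      = ∑ i ∈ S, ((∏ l with l < i0 ∧ τ l = l, kk κ (r' l)) * yy t x τ r) *
        (κ ^ 2) ^ (S.filter fun l => l < i).card := by
    symm
    have hsub : S ⊆ Finset.univ.filter fun l => τ l = l := by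
      intro l; simp [hSdef]; tauto
    rw [← Finset.sum_subset hsub (f := fun i => (if r' i = true then
      (∏ l with l < i ∧ τ l = l, kk κ (r' l)) * yy t x τ (fl r' i) else 0))]
    · apply Finset.sum_congr rfl
      intro i hi
      rw [if_pos (hr'S i hi), claim _ i hi rfl]
      have : (Finset.univ.filter fun l => l < i ∧ τ l = l) =
          (Finset.univ.filter fun l => l < i0 ∧ τ l = l) ∪ (S.filter fun l => l < i) := by
        simp [hSdef] at hi
        ext l
        simp [hSdef]
        constructor
        · rintro ⟨a1, a2⟩
          simp [a2, a1]
          omega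
        · rintro (⟨a1, a2⟩ | a1)
          · exact ⟨by omega, a2⟩
          · tauto
      rw [this, Finset.prod_union]
      · rw [Finset.prod_congr rfl (s₁ := S.filter fun l => l < i) (g := fun _ => κ), Finset.prod_const]
        · ring
        · intro l hl
          simp only [Finset.mem_filter] at hl
          rw [hr'S l hl.1]; simp [kk]
      · rw [Finset.disjoint_left]
        intro l
        simp [hSdef]
        intro a1 a2 a3
        omega
    · intro l hl hlS
      simp at hl
      simp [hSdef, hl] at hlS
      have : r' l = false := by
        rw [hr', Function.update_apply, if_neg hlS.ne]
        exact hbefore l hl hlS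
      simp [this]
  rw [e3, ← Finset.mul_sum, sum_rank (fun m => (κ ^ 2) ^ m)] at r2
  have hSpos : 0 < S.card := Finset.card_pos.mpr ⟨i0, by simp [hSdef, hi0f]⟩
  have hg : ∑ m ∈ Finset.range S.card, (κ ^ 2) ^ m ≠ 0 := by
    intro h0
    have := geom_sum_mul (κ ^ 2) S.card
    rw [h0, zero_mul, ← pow_mul] at this
    exact hroot (2 * S.card) (by omega) (sub_eq_zero.mp this.symm)
  refine mul_ne_zero (mul_ne_zero ?_ hr) hg r2
  rw [Finset.prod_ne_zero_iff]
  intro l _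
  unfold kk
  split_ifs
  · exact hκ0
  · exact inv_ne_zero hκ0

lemma x_zero {t κ : ℂ} (ht : t ≠ 0) (hκ : κ = -t⁻¹ ^ 2) (hroot : ∀ m : ℕ, 0 < m → κ ^ m ≠ 1)
    (x : (Fin N → Bool) → ℂ) (hx : KerE κ x) (hw : Wt0 κ x)
    (hp : ∀ π : Equiv.Perm (Fin N), INC π → (∀ v, π v ≠ v) → ∑ s, x s * vec (tm t) π s = 0) 
    (r : Fin N → Bool) : x r = 0 := by
  classical
  have := yy_zero ht hκ hroot x hx hw hp _ (1 : Equiv.Perm (Fin N))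
    ⟨by simp, by intro a b h1 h2; simp at h2; omega⟩ (by intro a b h1 h2; simp at h2; omega) rfl r
  unfold yy at this
  rw [Finset.sum_eq_single r] at this
  · simpa [uu, phi] using this
  · intro s _ hs
    have : ∃ l, s l ≠ r l := by
      by_contra hc; push Not at hc; exact hs (funext hc)
    obtain ⟨l, hl⟩ := this
    have : uu t (1 : Equiv.Perm (Fin N)) r s = 0 := by
      apply Finset.prod_eq_zero (Finset.mem_univ l)
      simp [phi, hl]
    rw [this, mul_zero]
  · simp

lemma vec_eq_uu (t : ℂ) {π : Equiv.Perm (Fin N)} (hf : ∀ v, π v ≠ v) (r s : Fin N → Bool) :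
    vec (tm t) π s = uu t π r s := by
  unfold uu vec
  apply Finset.prod_congr rfl
  intro l _
  simp [phi, psi, hf]

lemma vec_ne {t : ℂ} (ht : t ≠ 0) {π : Equiv.Perm (Fin N)} (h : ∀ v, π (π v) = v)
    (hf : ∀ v, π v ≠ v) (s : Fin N → Bool) (hs : vec (tm t) π s ≠ 0) (l : Fin N) :
    s (π l) = !s l := by
  rw [vec_eq_uu t hf s] at hs
  exact (uu_ne ht h Finset.univ (by simp) hs).1 l (Finset.mem_univ l) (hf l)

lemma vec_ker {t κ : ℂ} (ht : t ≠ 0) (hκ : κ = -t⁻¹ ^ 2) {π : Equiv.Perm (Fin N)} (h : INC π)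
    (hf : ∀ v, π v ≠ v) : KerE κ (vec (tm t) π) := by
  classical
  intro s
  have := arcs_cancel ht hκ h (fun a b _ _ => hf b) s s true
  rw [Finset.filter_true_of_mem (fun v _ => hf v)] at this
  refine Eq.trans ?_ this
  apply Finset.sum_congr rfl
  intro i _
  rw [vec_eq_uu t hf s]

/-- the word of a matching -/
def word (π : Equiv.Perm (Fin N)) (i : Fin N) : Bool := decide (i < π i)

lemma word_inj {π ρ : Equiv.Perm (Fin N)} (h : INC π) (hf : ∀ v, π v ≠ v)
    (h' : INC ρ) (hf' : ∀ v, ρ v ≠ v) (hw : word π = word ρ) : π = ρ := by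
  classical
  have hw' : ∀ i, i < π i ↔ i < ρ i := by
    intro i
    have := congrFun hw i
    simpa [word] using this
  by_contra hne
  have aux : ∀ (π ρ : Equiv.Perm (Fin N)), INC π → (∀ v, π v ≠ v) → INC ρ → (∀ v, ρ v ≠ v) →
      (∀ i, i < π i ↔ i < ρ i) → ∀ i, i < π i → π i < ρ i →
      ∃ k, i < k ∧ k < π k ∧ π k ≠ ρ k := by
    intro π ρ h hf h' hf' hw i hi hlt
    have hj : ¬ π i < π (π i) := by rw [h.1]; exact not_lt.mpr hi.le
    have hk : ρ (π i) < π i := by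
      rw [hw] at hj
      exact lt_of_le_of_ne (not_lt.mp hj) (hf' _)
    have cl := h'.closed hi hlt
    refine ⟨ρ (π i), cl.1, ?_, ?_⟩
    · rw [hw, h'.1]; exact hk
    · rw [h'.1]
      exact (h.closed cl.1 hk).2.ne
  have hex : (Finset.univ.filter fun l => l < π l ∧ π l ≠ ρ l).Nonempty := by
    by_contra hc
    rw [Finset.not_nonempty_iff_eq_empty, Finset.filter_eq_empty_iff] at hc
    apply hne
    ext1 l
    rcases lt_or_gt_of_ne (hf l) with h1 | h1
    · have := hc (Finset.mem_univ (π l))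
      rw [h.1] at this
      have h2 : l = ρ (π l) := by tauto
      conv_rhs => rw [h2]
      rw [h'.1]
    · have := hc (Finset.mem_univ l)
      tauto
  obtain ⟨i, hi, hmax⟩ := Finset.exists_max_image _ id hex
  simp only [Finset.mem_filter, Finset.mem_univ, true_and, id] at hi hmax
  rcases lt_or_gt_of_ne hi.2 with h1 | h1
  · obtain ⟨k, k1, k2, k3⟩ := aux π ρ h hf h' hf' hw' i hi.1 h1
    exact absurd (hmax k ⟨k2, k3⟩) (not_le.mpr k1)
  · obtain ⟨k, k1, k2, k3⟩ := aux ρ π h' hf' h hf (fun i => (hw' i).symm) i ((hw' i).1 hi.1) h1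
    exact absurd (hmax k ⟨(hw' k).2 k2, k3.symm⟩) (not_le.mpr k1)

/-- sum of openers -/
def ff (s : Fin N → Bool) : ℕ := ∑ l : Fin N, if s l then (l : ℕ) else 0

lemma ff_double {π : Equiv.Perm (Fin N)} (h : ∀ v, π (π v) = v) (s : Fin N → Bool) :
    2 * ff s = ∑ l : Fin N, ((if s l then (l : ℕ) else 0) + (if s (π l) then (π l : ℕ) else 0)) := by
  rw [Finset.sum_add_distrib, Equiv.sum_comp π (fun l => if s l then (l : ℕ) else 0)]
  unfold ff; ring

lemma ff_lt {π : Equiv.Perm (Fin N)} (h : ∀ v, π (π v) = v) (hf : ∀ v, π v ≠ v) (s : Fin N → Bool)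
    (hs : ∀ l, s (π l) = !s l) (hne : s ≠ word π) : ff (word π) < ff s := by
  have : 2 * ff (word π) < 2 * ff s := by
    rw [ff_double h, ff_double h]
    have hd : ∀ l, (l < π l ∨ π l < l) := fun l => (lt_or_gt_of_ne (hf l)).symm
    apply Finset.sum_lt_sum
    · intro l _
      rw [hs l]
      rcases hd l with h1 | h1 <;> cases s l <;> simp [word, h, h1, not_lt.mpr h1.le] <;> omega
    · have : ∃ l, s l ≠ word π l := by
        by_contra hc; push Not at hc; exact hne (funext hc)
      obtain ⟨l, hl⟩ := this
      refine ⟨l, Finset.mem_univ l, ?_⟩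
      rw [hs l]
      rcases hd l with h1 | h1 <;> cases hsl : s l <;> simp [word, h, h1, not_lt.mpr h1.le, hsl] at hl ⊢ <;> omega
  omega

lemma vec_word {t : ℂ} (ht : t ≠ 0) {π : Equiv.Perm (Fin N)} (h : ∀ v, π (π v) = v) :
    vec (tm t) π (word π) ≠ 0 := by
  unfold vec
  rw [Finset.prod_ne_zero_iff]
  intro l _
  unfold psi
  split_ifs with h1
  · rw [tm_ne t ht]
    simp [word, h, h1, h1.le]
  · simp

end TLGram

open TLGram in
/-- If `A` is a nonzero complex number that is not a root of unity, then the Gram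
matrix of Lickorish's bilinear form on `TL_n`, with entries `δ^{c(π,ρ)}` for
`δ = -A² - A^{-2}`, is nonsingular. -/
theorem gram_det_nonsingular (n : ℕ) (hn : 1 ≤ n) (A : ℂ) (hA : A ≠ 0)
    (hroot : ∀ k : ℕ, 0 < k → A ^ k ≠ 1) :
    (Matrix.of fun π ρ : NCMatching n =>
        (-A ^ 2 - A ^ (-2 : ℤ)) ^ loopCount n π.1 ρ.1).det ≠ 0 := by
  classical
  intro hdet
  obtain ⟨c, hc0, hc⟩ := Matrix.exists_mulVec_eq_zero_iff.mpr hdet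
  have hI : Complex.I ^ 2 = -1 := Complex.I_sq
  obtain ⟨t, htdef⟩ : ∃ t, t = Complex.I * A := ⟨_, rfl⟩
  have ht : t ≠ 0 := by rw [htdef]; exact mul_ne_zero Complex.I_ne_zero hA
  have ht2 : t ^ 2 = -A ^ 2 := by rw [htdef, mul_pow, hI]; ring
  obtain ⟨κ, hκ⟩ : ∃ κ, κ = -t⁻¹ ^ 2 := ⟨_, rfl⟩
  have hκA : κ = (A ^ 2)⁻¹ := by
    rw [hκ, inv_pow, ht2, inv_neg, neg_neg]
  have hκ0 : κ ≠ 0 := by rw [hκA]; simp [hA]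
  have hκroot : ∀ m : ℕ, 0 < m → κ ^ m ≠ 1 := by
    intro m hm h1
    rw [hκA, inv_pow, inv_eq_one, ← pow_mul] at h1
    exact hroot _ (by omega) h1
  have hdl : dl (tm t) = -A ^ 2 - A ^ (-2 : ℤ) := by
    have e1 : dl (tm t) = t ^ 2 + (t ^ 2)⁻¹ := by
      simp [dl, tm]; ring
    rw [e1, ht2, inv_neg, zpow_neg]
    norm_cast
  have hdl0 : dl (tm t) ≠ 0 := by
    rw [hdl, zpow_neg]
    intro h0
    have h4 : A ^ 4 = -1 := by
      have : A ^ (2 : ℤ) = A ^ 2 := by norm_cast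
      rw [this] at h0
      field_simp at h0
      linear_combination -h0
    exact hroot 8 (by norm_num) (by rw [show A ^ 8 = (A ^ 4) ^ 2 by ring, h4]; norm_num)
  have hinc : ∀ π : NCMatching n, INC π.1 := fun π =>
    ⟨π.2.2.1, fun a b h1 h2 h3 => π.2.2.2 a b _ _ h1 h2 h3 rfl rfl⟩
  set x : (Fin (2 * n) → Bool) → ℂ := fun s => ∑ π : NCMatching n, c π * vec (tm t) π.1 s with hx
  have hker : KerE κ x := by
    intro s
    have : ∀ i, (if s i = true then HH κ s i * x (fl s i) else 0) = ∑ π : NCMatching n,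
        c π * (if s i = true then HH κ s i * vec (tm t) π.1 (fl s i) else 0) := by
      intro i
      split_ifs
      · rw [hx, Finset.mul_sum]
        exact Finset.sum_congr rfl fun π _ => by ring
      · simp
    rw [Finset.sum_congr rfl fun i _ => this i, Finset.sum_comm]
    apply Finset.sum_eq_zero
    intro π _
    rw [← Finset.mul_sum, vec_ker ht hκ (hinc π) π.2.1 s, mul_zero]
  have hwt : Wt0 κ x := by
    intro s hs
    obtain ⟨π, _, hπ⟩ := Finset.exists_ne_zero_of_sum_ne_zero hs
    have := vec_ne ht (hinc π).1 π.2.1 s (mul_ne_zero_iff.mp hπ).2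
    exact kk_bal κ hκ0 (hinc π).1 s Finset.univ (by simp) (fun l _ => this l)
  have hperp : ∀ ρ : Equiv.Perm (Fin (2 * n)), INC ρ → (∀ v, ρ v ≠ v) →
      ∑ s, x s * vec (tm t) ρ s = 0 := by
    intro ρ hρ hρf
    let ρ' : NCMatching n := ⟨ρ, hρf, hρ.1, fun a b c d h1 h2 h3 h4 h5 => by
      subst h4; subst h5; exact hρ.2 a b h1 h2 h3⟩
    have h0 := congrFun hc ρ'
    simp only [Matrix.mulVec, dotProduct, Matrix.of_apply, Pi.zero_apply] at h0
    rw [← h0]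
    simp only [hx, Finset.sum_mul]
    rw [Finset.sum_comm]
    apply Finset.sum_congr rfl
    intro π _
    have hz := Z_loop ρ π.1 hρ hρf (hinc π) π.2.1 (tm t) (tm_Sq t ht) hdl0
    rw [hdl] at hz
    unfold loopCount
    rw [← hz]
    unfold Z
    rw [Finset.sum_mul]
    exact Finset.sum_congr rfl fun s _ => by ring
  have hx0 := x_zero ht hκ hκroot x hker hwt hperp
  apply hc0
  by_contra hcne
  have hS : (Finset.univ.filter fun π : NCMatching n => c π ≠ 0).Nonempty := by
    by_contra hcon
    rw [Finset.not_nonempty_iff_eq_empty, Finset.filter_eq_empty_iff] at hcon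
    apply hcne
    funext π
    have := hcon (Finset.mem_univ π)
    simpa using this
  obtain ⟨ρ, hρ, hmin⟩ := Finset.exists_min_image _ (fun π : NCMatching n => ff (word π.1)) hS
  simp only [Finset.mem_filter, Finset.mem_univ, true_and] at hρ hmin
  have h0 := hx0 (word ρ.1)
  simp only [hx] at h0
  rw [Finset.sum_eq_single ρ] at h0
  · exact mul_ne_zero hρ (vec_word ht (hinc ρ).1) h0
  · intro π _ hne
    by_contra hcon
    obtain ⟨h1, h2⟩ := mul_ne_zero_iff.mp hcon
    have h3 := vec_ne ht (hinc π).1 π.2.1 _ h2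
    by_cases h4 : word ρ.1 = word π.1
    · exact hne (Subtype.ext (word_inj (hinc π) π.2.1 (hinc ρ) ρ.2.1 h4.symm))
    · exact absurd (hmin π h1) (not_le.mpr (ff_lt (hinc π).1 π.2.1 _ h3 h4))
  · simp
end
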